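/- arXiv:2111.07595 — 2 statements merged into one kernel-verified Lean document; each statement's English description precedes it below -/
import Mathlib

section
/- Let n be a positive integer with n ≡ 1 (mod 4) and M = (n-1)/2 or n-1. Then Σ_{k=0}^{M} [6k+1]·(q;q²)_k²·(q²;q⁴)_k·(q;q⁴)_k² / ((q²;q²)_k²·(q⁴;q⁴)_k³) · q^{2k} ≡ [n]·((q²;q⁴)_{(n-1)/4})²/((q⁴;q⁴)_{(n-1)/4})² · (1 + [n]²(2-q^n)·Σ_{j=1}^{(n-1)/2} (-1)^{j+1} q^{2j}/[2j]²) modulo [n]·Φ_n(q)⁴. -/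
/-- The q-shifted factorial `(x;q)_k = (1-x)(1-xq)⋯(1-xq^{k-1})`. -/
def qPoch {K : Type*} [Field K] (x q : K) (k : ℕ) : K :=
  ∏ i ∈ Finset.range k, (1 - x * q ^ i)

/-- The q-integer `[r] = 1 + q + ⋯ + q^{r-1}`. -/
def qint {K : Type*} [Field K] (q : K) (r : ℕ) : K :=
  ∑ i ∈ Finset.range r, q ^ i

section QuadraticSum

open Finset

/-- The product `(1 - q ^ a * x) * (1 - q ^ a / x)` in terms of `U = x + 1 / x`. -/
def quadFactor {A : Type*} [CommRing A] (q U : A) (a : ℕ) : A :=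
  1 + q ^ (2 * a) - q ^ a * U

/-- The ratio of consecutive terms, up to the very-well-poised factor, of the terminating
quadratic sum; `T` stands for `q ^ (4 * N)`, where `N` is the length of the sum. -/
def rahmanRatio {F : Type*} [Field F] (q U y T : F) (i : ℕ) : F :=
  (1 - q ^ (2 * i + 1)) * quadFactor q U (2 * i + 1) * (1 - q ^ (4 * i + 1) * y) *
      (y - T * q ^ (4 * i + 3)) * (T - q ^ (4 * i)) /
    ((1 - q ^ (4 * i + 4)) * quadFactor q U (4 * i + 4) * (y - q ^ (2 * i + 2)) *
      (T - y * q ^ (2 * i)) * (1 - T * q ^ (2 * i + 3)))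

/-- The closed form of the terminating quadratic sum. -/
def rahmanValue {F : Type*} [Field F] (q U y : F) (N : ℕ) : F :=
  (1 - q) * ∏ j ∈ range N,
    (1 - q ^ (4 * j + 3)) * (1 - q ^ (4 * j + 5)) *
        (y ^ 2 + q ^ (8 * j + 6) - q ^ (4 * j + 3) * U * y) /
      ((y - q ^ (4 * j + 2)) * (y - q ^ (4 * j + 4)) * quadFactor q U (4 * j + 4))

section Rahman

variable {F : Type*} [Field F] {q U y : F}

private def wzRatio (q U y T : F) (i : ℕ) : F :=
  (1 - q ^ (2 * i + 1)) * quadFactor q U (2 * i + 1) * (1 - q ^ (4 * i + 1) * y) *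
      (y - T * q ^ (4 * i + 3)) * (T * q ^ 4 - q ^ (4 * i)) /
    (q ^ 4 * (1 - q ^ (4 * i + 4)) * quadFactor q U (4 * i + 4) * (y - q ^ (2 * i + 2)) *
      (T - y * q ^ (2 * i)) * (1 - T * q ^ (2 * i + 7)))

private def wzCert (q U y T : F) (k : ℕ) : F :=
  (1 - q ^ (4 * k)) * quadFactor q U (4 * k) * (y - q ^ (2 * k)) * (T * q ^ 2 - y * q ^ (2 * k)) *
    (1 - T * q ^ (2 * k + 5))

private theorem wz_identity {K T a : F} (hq : q ≠ 0) (h4 : T * q ^ 4 - 1 ≠ 0)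
    (h3 : 1 - T * q ^ 3 ≠ 0) (h5 : 1 - T * q ^ 5 ≠ 0) (hy2 : y - T * q ^ 2 ≠ 0)
    (hy3 : y - T * q ^ 3 ≠ 0) (hy4 : y - T * q ^ 4 ≠ 0)
    (hU : 1 + T ^ 2 * q ^ 8 - T * q ^ 4 * U ≠ 0) :
    (1 - K ^ 3 * q) * K *
      (a * ((y - T * (K ^ 2 * q ^ 3)) * (T * q ^ 4 - y * (K * q ^ 2)) * (T * q ^ 4 - y * K)) /
          ((y - T * q ^ 3) * (-q ^ 2 * (y - T * q ^ 2)) * -(y - T * q ^ 4)) -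
        (1 - T * q ^ 3) * (1 - T * q ^ 5) * (y ^ 2 + T ^ 2 * q ^ 6 - T * q ^ 3 * U * y) /
            ((y - T * q ^ 2) * (y - T * q ^ 4) * (1 + T ^ 2 * q ^ 8 - T * q ^ 4 * U)) *
          (a * ((T * q ^ 4 - K ^ 2) * (1 - T * (K * q ^ 3)) * (1 - T * (K * q ^ 5))) /
            ((T * q ^ 4 - 1) * (1 - T * q ^ 3) * (1 - T * q ^ 5)))) =
    -(T * q ^ 4 * (y - T ^ 2 * q ^ 7)) /
          ((T * q ^ 4 - 1) * (y - T * q ^ 3) * (y - T * q ^ 2) * (y - T * q ^ 4) *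
            (1 + T ^ 2 * q ^ 8 - T * q ^ 4 * U)) *
        (a *
          ((1 - K * q) * (1 + K ^ 2 * q ^ 2 - K * q * U) * (1 - K ^ 2 * q * y) *
              (y - T * (K ^ 2 * q ^ 3)) * (T * q ^ 4 - K ^ 2) / q ^ 2)) -
      -(T * q ^ 4 * (y - T ^ 2 * q ^ 7)) /
            ((T * q ^ 4 - 1) * (y - T * q ^ 3) * (y - T * q ^ 2) * (y - T * q ^ 4) *
              (1 + T ^ 2 * q ^ 8 - T * q ^ 4 * U)) *
          a *
        ((1 - K ^ 2) * (1 + K ^ 4 - K ^ 2 * U) * (y - K) * (T * q ^ 2 - y * K) *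
          (1 - T * (K * q ^ 5))) := by
  have key : K * (1 - K ^ 3 * q) *
      ((T * q ^ 4 - 1) * (1 + T ^ 2 * q ^ 8 - T * q ^ 4 * U) * (y - T * (K ^ 2 * q ^ 3)) *
          (T * q ^ 4 - y * (K * q ^ 2)) * (T * q ^ 4 - y * K) -
        q ^ 2 * (y ^ 2 + T ^ 2 * q ^ 6 - T * q ^ 3 * U * y) * (y - T * q ^ 3) *
          (T * q ^ 4 - K ^ 2) * (1 - T * (K * q ^ 3)) * (1 - T * (K * q ^ 5))) =
      -(T * q ^ 4 * (y - T ^ 2 * q ^ 7)) *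
        ((1 - K * q) * (1 + K ^ 2 * q ^ 2 - K * q * U) * (1 - K ^ 2 * q * y) *
          (y - T * (K ^ 2 * q ^ 3)) * (T * q ^ 4 - K ^ 2) -
        q ^ 2 * ((1 - K ^ 2) * (1 + K ^ 4 - K ^ 2 * U) * (y - K) * (T * q ^ 2 - y * K) *
          (1 - T * (K * q ^ 5)))) := by
    ring
  generalize hd2 : y - T * q ^ 2 = d2 at *
  generalize hd3 : y - T * q ^ 3 = d3 at *
  generalize hd4 : y - T * q ^ 4 = d4 at *
  generalize hdU : 1 + T ^ 2 * q ^ 8 - T * q ^ 4 * U = dU at *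
  generalize hd1 : T * q ^ 4 - 1 = d1 at *
  generalize 1 - T * q ^ 3 = d6 at *
  generalize 1 - T * q ^ 5 = d5 at *
  generalize T * q ^ 4 - y * (K * q ^ 2) = z1 at *
  generalize T * q ^ 4 - y * K = z2 at *
  generalize T * q ^ 4 - K ^ 2 = z3 at *
  generalize 1 - T * (K * q ^ 3) = z4 at *
  generalize 1 - T * (K * q ^ 5) = z5 at *
  generalize 1 + K ^ 2 * q ^ 2 - K * q * U = z6 at *
  generalize 1 + K ^ 4 - K ^ 2 * U = z7 at *
  generalize y - T ^ 2 * q ^ 7 = z8 at *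
  generalize y - T * (K ^ 2 * q ^ 3) = z9 at *
  generalize y ^ 2 + T ^ 2 * q ^ 6 - T * q ^ 3 * U * y = z10 at *
  generalize 1 - K ^ 2 * q * y = z11 at *
  generalize 1 - K ^ 3 * q = z12 at *
  generalize T * q ^ 2 - y * K = z13 at *
  generalize T * q ^ 4 * z8 = z14 at *
  field_simp
  linear_combination a * key

set_option maxHeartbeats 2000000 in
theorem rahman_terminating (hq : q ≠ 0) (h1 : ∀ j, 0 < j → 1 - q ^ j ≠ 0)
    (hU : ∀ j, quadFactor q U (4 * j + 4) ≠ 0) (hy : ∀ j, y - q ^ (2 * j + 2) ≠ 0)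
    (hy' : ∀ i j, q ^ (4 * i) - y * q ^ (2 * j) ≠ 0) (hy3 : ∀ j, y - q ^ (4 * j + 3) ≠ 0)
    (N : ℕ) :
    ∑ k ∈ range (N + 1), (1 - q ^ (6 * k + 1)) * q ^ (2 * k) *
      ∏ i ∈ range k, rahmanRatio q U y (q ^ (4 * N)) i = rahmanValue q U y N := by
  induction N with
  | zero => simp [rahmanValue]
  | succ N ih =>
    have hT0 : q ^ (4 * N) ≠ 0 := pow_ne_zero _ hq
    set T := q ^ (4 * N) with hT
    have hT' : q ^ (4 * (N + 1)) = T * q ^ 4 := by rw [hT]; ring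
    have hTq : ∀ j, 0 < j → 1 - T * q ^ j ≠ 0 := fun j hj => by
      rw [hT, ← pow_add]; exact h1 _ (by omega)
    have hTy : ∀ j, T - y * q ^ (2 * j) ≠ 0 := fun j => hy' N j
    have hTy4 : ∀ j, T * q ^ 4 - y * q ^ (2 * j) ≠ 0 := fun j => by
      rw [← hT']; exact hy' _ j
    have hyT2 : y - T * q ^ 2 ≠ 0 := by
      have := hy (2 * N); rwa [show 2 * (2 * N) + 2 = 4 * N + 2 by ring, pow_add] at this
    have hyT4 : y - T * q ^ 4 ≠ 0 := by
      have := hy (2 * N + 1)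
      rwa [show 2 * (2 * N + 1) + 2 = 4 * N + 4 by ring, pow_add] at this
    have hyT3 : y - T * q ^ 3 ≠ 0 := by
      have := hy3 N; rwa [pow_add] at this
    have hUT : 1 + T ^ 2 * q ^ 8 - T * q ^ 4 * U ≠ 0 := by
      have := hU N
      rw [quadFactor] at this
      rw [hT]; convert this using 1; ring
    set A : ℕ → F := fun k => ∏ i ∈ range k, wzRatio q U y T i with hA
    have hA0 : A 0 = 1 := by simp [hA]
    have hAs : ∀ k, A (k + 1) = A k * wzRatio q U y T k := fun k => prod_range_succ _ _
    set a0 := (T * q ^ 4 - 1) * (1 - T * q ^ 3) * (1 - T * q ^ 5) with ha0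
    have ha0' : a0 ≠ 0 := by
      refine mul_ne_zero (mul_ne_zero ?_ (hTq _ (by norm_num))) (hTq _ (by norm_num))
      have := hTq 4 (by norm_num)
      intro h; apply this; linear_combination -h
    set b0 := (y - T * q ^ 3) * (T * q ^ 4 - y * q ^ 2) * (T * q ^ 4 - y) with hb0
    have hb0' : b0 ≠ 0 := by
      refine mul_ne_zero (mul_ne_zero hyT3 ?_) ?_
      · have := hTy4 1; simpa using this
      · have := hTy4 0; simpa using this
    have key1 : ∀ k, (∏ i ∈ range k, rahmanRatio q U y T i) * a0 =
        A k * ((T * q ^ 4 - q ^ (4 * k)) * (1 - T * q ^ (2 * k + 3)) * (1 - T * q ^ (2 * k + 5))) := by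
      intro k
      induction k with
      | zero => simp [hA0, ha0]
      | succ k ihk =>
        rw [prod_range_succ, mul_right_comm, ihk, hAs, rahmanRatio, wzRatio]
        have e1 := h1 (4 * k + 4) (by omega)
        have e2 := hU k
        have e3 := hy k
        have e4 := hTy k
        have e5 := hTq (2 * k + 3) (by omega)
        have e7 := hTq (2 * k + 7) (by omega)
        rw [show 2 * (k + 1) + 3 = 2 * k + 5 by ring, show 2 * (k + 1) + 5 = 2 * k + 7 by ring,
          show 4 * (k + 1) = 4 * k + 4 by ring, pow_add q (4 * k) 4] at *
        generalize quadFactor q U (4 * k + 4) = z1 at *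
        field_simp
    have key2 : ∀ k, (∏ i ∈ range k, rahmanRatio q U y (T * q ^ 4) i) * b0 =
        A k * ((y - T * q ^ (4 * k + 3)) * (T * q ^ 4 - y * q ^ (2 * k + 2)) *
          (T * q ^ 4 - y * q ^ (2 * k))) := by
      intro k
      induction k with
      | zero => simp [hA0, hb0]
      | succ k ihk =>
        rw [prod_range_succ, mul_right_comm, ihk, hAs, rahmanRatio, wzRatio]
        have e1 := h1 (4 * k + 4) (by omega)
        have e2 := hU k
        have e3 := hy k
        have e4 := hTy k
        have e5 := hTy4 k
        have e7 := hTq (2 * k + 7) (by omega)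
        have e7' : 1 - T * q ^ 4 * q ^ (2 * k + 3) ≠ 0 := by
          convert e7 using 2; ring
        generalize quadFactor q U (4 * k + 4) = z1 at *
        generalize quadFactor q U (2 * k + 1) = z2 at *
        rw [mul_div_assoc', mul_div_assoc', div_mul_eq_mul_div, div_eq_div_iff (by positivity) (by positivity)]
        ring
    set c := -(T * q ^ 4 * (y - T ^ 2 * q ^ 7)) / ((T * q ^ 4 - 1) * (y - T * q ^ 3) *
      (y - T * q ^ 2) * (y - T * q ^ 4) * (1 + T ^ 2 * q ^ 8 - T * q ^ 4 * U)) with hc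
    set ρ := (1 - T * q ^ 3) * (1 - T * q ^ 5) * (y ^ 2 + T ^ 2 * q ^ 6 - T * q ^ 3 * U * y) /
      ((y - T * q ^ 2) * (y - T * q ^ 4) * (1 + T ^ 2 * q ^ 8 - T * q ^ 4 * U)) with hρ
    have hval : rahmanValue q U y (N + 1) = ρ * rahmanValue q U y N := by
      rw [rahmanValue, rahmanValue, prod_range_succ, hρ, hT, quadFactor]
      ring
    have hcert : ∀ k, wzRatio q U y T k * wzCert q U y T (k + 1) =
        (1 - q ^ (2 * k + 1)) * quadFactor q U (2 * k + 1) * (1 - q ^ (4 * k + 1) * y) *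
          (y - T * q ^ (4 * k + 3)) * (T * q ^ 4 - q ^ (4 * k)) / q ^ 2 := by
      intro k
      rw [wzRatio, wzCert]
      have e1 := h1 (4 * k + 4) (by omega)
      have e2 := hU k
      have e3 := hy k
      have e4 := hTy k
      have e7 := hTq (2 * k + 7) (by omega)
      rw [show 4 * (k + 1) = 4 * k + 4 by ring, show 2 * (k + 1) = 2 * k + 2 by ring,
        show 2 * k + 2 + 5 = 2 * k + 7 by ring]
      have e8 : T * q ^ 2 - y * q ^ (2 * k + 2) = q ^ 2 * (T - y * q ^ (2 * k)) := by ring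
      rw [e8]
      generalize quadFactor q U (4 * k + 4) = z1 at *
      generalize quadFactor q U (2 * k + 1) = z2 at *
      field_simp
    have hstep : ∀ k, (1 - q ^ (6 * k + 1)) * q ^ (2 * k) *
          (∏ i ∈ range k, rahmanRatio q U y (T * q ^ 4) i -
            ρ * ∏ i ∈ range k, rahmanRatio q U y T i) =
        c * A (k + 1) * wzCert q U y T (k + 1) - c * A k * wzCert q U y T k := by
      intro k
      have k1 := eq_div_of_mul_eq ha0' (key1 k)
      have k2 := eq_div_of_mul_eq hb0' (key2 k)
      rw [k1, k2, hAs, mul_assoc c, mul_assoc (A k), hcert, wzCert, hc, hρ, ha0, hb0,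
        quadFactor, quadFactor]
      have g1 : T * q ^ 4 - 1 ≠ 0 := fun h => ha0' (by rw [ha0, h]; ring)
      have g2 := hTq 3 (by norm_num)
      have g3 := hTq 5 (by norm_num)
      have g4 : T * q ^ 4 - y * q ^ 2 = -q ^ 2 * (y - T * q ^ 2) := by ring
      have g5 : T * q ^ 4 - y = -(y - T * q ^ 4) := by ring
      rw [g4, g5]
      have x1 : q ^ (6 * k + 1) = (q ^ (2 * k)) ^ 3 * q := by ring
      have x2 : q ^ (4 * k) = (q ^ (2 * k)) ^ 2 := by ring
      have x3 : q ^ (4 * k + 3) = (q ^ (2 * k)) ^ 2 * q ^ 3 := by ring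
      have x4 : q ^ (2 * k + 2) = q ^ (2 * k) * q ^ 2 := by ring
      have x5 : q ^ (2 * k + 3) = q ^ (2 * k) * q ^ 3 := by ring
      have x6 : q ^ (2 * k + 5) = q ^ (2 * k) * q ^ 5 := by ring
      have x7 : q ^ (2 * k + 1) = q ^ (2 * k) * q := by ring
      have x8 : q ^ (4 * k + 1) = (q ^ (2 * k)) ^ 2 * q := by ring
      have x9 : q ^ (2 * (2 * k + 1)) = (q ^ (2 * k)) ^ 2 * q ^ 2 := by ring
      have x10 : q ^ (2 * (4 * k)) = (q ^ (2 * k)) ^ 4 := by ring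
      rw [x1, x2, x3, x4, x5, x6, x7, x8, x9, x10]
      generalize q ^ (2 * k) = K
      generalize A k = a
      clear_value T
      exact wz_identity hq g1 g2 g3 hyT2 hyT3 hyT4 hUT
    have hsum := sum_range_sub (fun k => c * A k * wzCert q U y T k) (N + 2)
    simp only [← hstep, mul_sub, sum_sub_distrib] at hsum
    have hA2 : A (N + 2) = 0 := by
      have : wzRatio q U y T (N + 1) = 0 := by
        rw [wzRatio, show T * q ^ 4 - q ^ (4 * (N + 1)) = 0 by rw [hT']; ring]; simp
      rw [hAs, this, mul_zero]
    have hC0 : wzCert q U y T 0 = 0 := by simp [wzCert]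
    rw [hA2, hC0, mul_zero, zero_mul, mul_zero, sub_zero] at hsum
    have hlast : ∏ i ∈ range (N + 1), rahmanRatio q U y T i = 0 := by
      rw [prod_range_succ, rahmanRatio, hT]; simp
    rw [hval, hT', ← ih, mul_sum, sub_eq_zero.mp hsum, sum_range_succ, hlast]
    simp only [mul_zero, add_zero]
    exact sum_congr rfl fun k _ => by ring

end Rahman

/-- The numerator of the ratio of consecutive terms of the symmetric quadratic sum. -/
def numFactor {A : Type*} [CommRing A] (q U V : A) (i : ℕ) : A :=
  quadFactor q U (2 * i + 1) * quadFactor q V (4 * i + 1) * (1 - q ^ (4 * i + 2))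

/-- The denominator of the ratio of consecutive terms of the symmetric quadratic sum. -/
def denFactor {A : Type*} [CommRing A] (q U V : A) (i : ℕ) : A :=
  quadFactor q U (4 * i + 4) * quadFactor q V (2 * i + 2) * (1 - q ^ (4 * i + 4))

/-- The part of the `k`-th term of the cleared sum that does not involve `U` and `V`. -/
def clearedCoeff {A : Type*} [CommRing A] (q : A) (m k : ℕ) : A :=
  (1 - q ^ (6 * k + 1)) * q ^ (2 * k) *
    ((∏ i ∈ range k, (1 - q ^ (4 * i + 2))) * ∏ i ∈ Ico k m, (1 - q ^ (4 * i + 4)))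

/-- The part of the `k`-th term of the cleared sum that involves `U`. -/
def clearedLeft {A : Type*} [CommRing A] (q U : A) (m k : ℕ) : A :=
  (∏ i ∈ range k, quadFactor q U (2 * i + 1)) * ∏ i ∈ Ico k m, quadFactor q U (4 * i + 4)

/-- The part of the `k`-th term of the cleared sum that involves `V`. -/
def clearedRight {A : Type*} [CommRing A] (q V : A) (m k : ℕ) : A :=
  (∏ i ∈ range k, quadFactor q V (4 * i + 1)) * ∏ i ∈ Ico k m, quadFactor q V (2 * i + 2)

/-- The symmetric quadratic sum, truncated at `m` and multiplied by its common denominator. -/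
def clearedSum {A : Type*} [CommRing A] (q U V : A) (m : ℕ) : A :=
  ∑ k ∈ range (m + 1), clearedCoeff q m k * clearedLeft q U m k * clearedRight q V m k

section Map

variable {A B : Type*} [CommRing A] [CommRing B] (φ : A →+* B)

theorem map_quadFactor (q U : A) (a : ℕ) :
    φ (quadFactor q U a) = quadFactor (φ q) (φ U) a := by
  simp [quadFactor]

theorem map_denFactor (q U V : A) (i : ℕ) :
    φ (denFactor q U V i) = denFactor (φ q) (φ U) (φ V) i := by
  simp [denFactor, map_quadFactor]

theorem map_clearedCoeff (q : A) (m k : ℕ) :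
    φ (clearedCoeff q m k) = clearedCoeff (φ q) m k := by
  simp [clearedCoeff, map_prod]

theorem map_clearedLeft (q U : A) (m k : ℕ) :
    φ (clearedLeft q U m k) = clearedLeft (φ q) (φ U) m k := by
  simp [clearedLeft, map_prod, map_quadFactor]

theorem map_clearedRight (q U : A) (m k : ℕ) :
    φ (clearedRight q U m k) = clearedRight (φ q) (φ U) m k := by
  simp [clearedRight, map_prod, map_quadFactor]

theorem map_clearedSum (q U V : A) (m : ℕ) :
    φ (clearedSum q U V m) = clearedSum (φ q) (φ U) (φ V) m := by
  simp [clearedSum, map_clearedCoeff, map_clearedLeft, map_clearedRight]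

end Map

section Field

variable {F : Type*} [Field F] {q : F}

theorem clearedSum_eq_mul_sum {U V : F} {m : ℕ} (h : ∀ i < m, denFactor q U V i ≠ 0) :
    clearedSum q U V m = (∏ i ∈ range m, denFactor q U V i) *
      ∑ k ∈ range (m + 1), (1 - q ^ (6 * k + 1)) * q ^ (2 * k) *
        ∏ i ∈ range k, numFactor q U V i / denFactor q U V i := by
  rw [clearedSum, mul_sum]
  refine sum_congr rfl fun k hk => ?_
  have hk' : k ≤ m := by simpa [Nat.lt_succ_iff] using hk
  rw [prod_div_distrib, ← prod_range_mul_prod_Ico _ hk']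
  have h0 : ∏ i ∈ range k, denFactor q U V i ≠ 0 :=
    prod_ne_zero_iff.mpr fun i hi => h i ((mem_range.mp hi).trans_le hk')
  field_simp
  simp only [clearedCoeff, clearedLeft, clearedRight, numFactor, denFactor, prod_mul_distrib]
  ring

theorem pow_sub_pow_ne_zero (hq : q ≠ 0) (h1 : ∀ j, 0 < j → 1 - q ^ j ≠ 0) {a b : ℕ}
    (hab : a ≠ b) : q ^ a - q ^ b ≠ 0 := by
  rcases lt_or_gt_of_ne hab with h | h
  · obtain ⟨c, rfl⟩ := Nat.exists_eq_add_of_lt h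
    have : q ^ a - q ^ (a + c + 1) = q ^ a * (1 - q ^ (c + 1)) := by ring
    rw [this]
    exact mul_ne_zero (pow_ne_zero _ hq) (h1 _ (by omega))
  · obtain ⟨c, rfl⟩ := Nat.exists_eq_add_of_lt h
    have : q ^ (b + c + 1) - q ^ b = -(q ^ b * (1 - q ^ (c + 1))) := by ring
    rw [this]
    exact neg_ne_zero.mpr (mul_ne_zero (pow_ne_zero _ hq) (h1 _ (by omega)))

theorem quadFactor_mul_pow {V : F} {n : ℕ} (hV : V * q ^ n = 1 + q ^ (2 * n)) (a : ℕ) :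
    quadFactor q V a * q ^ n = (1 - q ^ (a + n)) * (q ^ n - q ^ a) := by
  rw [quadFactor]
  linear_combination (-q ^ a) * hV

theorem quadFactor_ne_zero (hq : q ≠ 0) (h1 : ∀ j, 0 < j → 1 - q ^ j ≠ 0) {V : F} {n : ℕ}
    (hV : V * q ^ n = 1 + q ^ (2 * n)) {a : ℕ} (ha : 0 < a) (han : a ≠ n) :
    quadFactor q V a ≠ 0 := by
  intro h
  have := quadFactor_mul_pow hV a
  rw [h, zero_mul] at this
  exact mul_ne_zero (h1 _ (by omega)) (pow_sub_pow_ne_zero hq h1 han.symm) this.symm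

theorem rahmanValue_self (hq : q ≠ 0) (h1 : ∀ j, 0 < j → 1 - q ^ j ≠ 0) {U : F}
    (hU : ∀ j, quadFactor q U (4 * j + 4) ≠ 0) (N : ℕ) :
    rahmanValue q U q N = (1 - q ^ (4 * N + 1)) *
      ∏ j ∈ range N, quadFactor q U (4 * j + 2) / quadFactor q U (4 * j + 4) := by
  rw [rahmanValue]
  induction N with
  | zero => simp
  | succ N ih =>
    rw [prod_range_succ, prod_range_succ, ← mul_assoc, ih]
    have e1 := h1 (4 * N + 1) (by omega)
    have e3 := h1 (4 * N + 3) (by omega)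
    have e2 := hU N
    have x1 : q - q ^ (4 * N + 2) = q * (1 - q ^ (4 * N + 1)) := by ring
    have x2 : q - q ^ (4 * N + 4) = q * (1 - q ^ (4 * N + 3)) := by ring
    have x3 : q ^ 2 + q ^ (8 * N + 6) - q ^ (4 * N + 3) * U * q =
        q ^ 2 * quadFactor q U (4 * N + 2) := by rw [quadFactor]; ring
    rw [x1, x2, x3, show 4 * (N + 1) + 1 = 4 * N + 5 by ring]
    generalize quadFactor q U (4 * N + 4) = z at *
    field_simp

theorem sum_of_right_special (hq : q ≠ 0) (h1 : ∀ j, 0 < j → 1 - q ^ j ≠ 0) {U V : F} {N m : ℕ}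
    (hNm : N ≤ m) (hU : ∀ j, quadFactor q U (4 * j + 4) ≠ 0)
    (hV : V * q ^ (4 * N + 1) = 1 + q ^ (2 * (4 * N + 1))) :
    ∑ k ∈ range (m + 1), (1 - q ^ (6 * k + 1)) * q ^ (2 * k) *
        ∏ i ∈ range k, numFactor q U V i / denFactor q U V i =
      (1 - q ^ (4 * N + 1)) *
        ∏ j ∈ range N, quadFactor q U (4 * j + 2) / quadFactor q U (4 * j + 4) := by
  rw [← rahmanValue_self hq h1 hU, ← rahman_terminating hq h1 hU]
  · have hsub : range (N + 1) ⊆ range (m + 1) := range_subset_range.mpr (by omega)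
    rw [← sum_subset hsub]
    · refine sum_congr rfl fun k hk => ?_
      congr 1
      refine prod_congr rfl fun i hi => ?_
      have hV0 : q ^ (4 * N + 1) ≠ 0 := pow_ne_zero _ hq
      have n1 := eq_div_of_mul_eq hV0 (quadFactor_mul_pow hV (4 * i + 1))
      have d1 := eq_div_of_mul_eq hV0 (quadFactor_mul_pow hV (2 * i + 2))
      rw [numFactor, denFactor, rahmanRatio, n1, d1]
      have e1 := h1 (2 * i + 1) (by omega)
      have e2 := h1 (4 * i + 4) (by omega)
      have e3 := hU i
      have e4 : q ^ (4 * N) - q ^ (2 * i + 1) ≠ 0 := pow_sub_pow_ne_zero hq h1 (by omega)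
      have e5 := h1 (4 * N + 2 * i + 3) (by omega)
      have x1 : q ^ (4 * N + 1) - q ^ (4 * i + 1) = q * (q ^ (4 * N) - q ^ (4 * i)) := by ring
      have x2 : q ^ (4 * N + 1) - q ^ (2 * i + 2) = q * (q ^ (4 * N) - q ^ (2 * i + 1)) := by ring
      have x3 : q - q ^ (4 * N) * q ^ (4 * i + 3) = q * (1 - q ^ (4 * i + 1 + (4 * N + 1))) := by
        ring
      have x4 : q - q ^ (2 * i + 2) = q * (1 - q ^ (2 * i + 1)) := by ring
      have x5 : q ^ (4 * N) - q * q ^ (2 * i) = q ^ (4 * N) - q ^ (2 * i + 1) := by ring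
      have x6 : 1 - q ^ (4 * N) * q ^ (2 * i + 3) = 1 - q ^ (4 * N + 2 * i + 3) := by ring
      have x7 : 1 - q ^ (2 * i + 2 + (4 * N + 1)) = 1 - q ^ (4 * N + 2 * i + 3) := by ring
      have x8 : 1 - q ^ (4 * i + 1) * q = 1 - q ^ (4 * i + 2) := by ring
      rw [x1, x2, x3, x4, x5, x6, x7, x8]
      generalize quadFactor q U (4 * i + 4) = z1 at *
      generalize quadFactor q U (2 * i + 1) = z2 at *
      generalize q ^ (4 * N + 1) = z3 at *
      generalize 1 - q ^ (4 * N + 2 * i + 3) = z4 at *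
      generalize 1 - q ^ (2 * i + 1) = z5 at *
      generalize q ^ (4 * N) - q ^ (2 * i + 1) = z6 at *
      generalize 1 - q ^ (4 * i + 4) = z7 at *
      field_simp
    · intro k _ hk
      have hNk : N ∈ range k := by
        rw [mem_range] at hk ⊢; omega
      have : numFactor q U V N = 0 := by
        have := quadFactor_mul_pow hV (4 * N + 1)
        rw [sub_self, mul_zero] at this
        rw [numFactor, (mul_eq_zero.mp this).resolve_right (pow_ne_zero _ hq)]
        ring
      rw [prod_eq_zero hNk (by rw [this, zero_div]), mul_zero]
  · intro j
    simpa using pow_sub_pow_ne_zero hq h1 (a := 1) (b := 2 * j + 2) (by omega)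
  · intro i j
    rw [← pow_succ']
    exact pow_sub_pow_ne_zero hq h1 (by omega)
  · intro j
    simpa using pow_sub_pow_ne_zero hq h1 (a := 1) (b := 4 * j + 3) (by omega)

theorem denFactor_ne_zero_of_right_special (hq : q ≠ 0) (h1 : ∀ j, 0 < j → 1 - q ^ j ≠ 0)
    {U V : F} {N : ℕ} (hU : ∀ j, quadFactor q U (4 * j + 4) ≠ 0)
    (hV : V * q ^ (4 * N + 1) = 1 + q ^ (2 * (4 * N + 1))) (i : ℕ) : denFactor q U V i ≠ 0 :=
  mul_ne_zero (mul_ne_zero (hU i) (quadFactor_ne_zero hq h1 hV (by omega) (by omega)))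
    (h1 _ (by omega))

theorem clearedSum_of_right_special (hq : q ≠ 0) (h1 : ∀ j, 0 < j → 1 - q ^ j ≠ 0) {U V : F}
    {N m : ℕ} (hNm : N ≤ m) (hU : ∀ j, quadFactor q U (4 * j + 4) ≠ 0)
    (hV : V * q ^ (4 * N + 1) = 1 + q ^ (2 * (4 * N + 1))) :
    clearedSum q U V m * ∏ j ∈ range N, quadFactor q U (4 * j + 4) =
      (1 - q ^ (4 * N + 1)) * (∏ j ∈ range N, quadFactor q U (4 * j + 2)) *
        ∏ i ∈ range m, denFactor q U V i := by
  rw [clearedSum_eq_mul_sum fun i _ => denFactor_ne_zero_of_right_special hq h1 hU hV i,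
    sum_of_right_special hq h1 hNm hU hV, prod_div_distrib]
  have : ∏ j ∈ range N, quadFactor q U (4 * j + 4) ≠ 0 := prod_ne_zero_iff.mpr fun j _ => hU j
  field_simp

end Field

section Symmetry

variable {F : Type*} [Field F] {q : F}

private def dualValue (q : F) (r N : ℕ) : F :=
  (1 - q ^ (4 * r + 1)) * ∏ j ∈ range r,
    ((1 - q ^ (4 * (j + N) + 3)) * (q ^ (4 * N) - q ^ (4 * j + 1))) /
      ((1 - q ^ (4 * (j + N) + 5)) * (q ^ (4 * N) - q ^ (4 * j + 3)))

private theorem dualValue_succ_left (h1 : ∀ j, 0 < j → 1 - q ^ j ≠ 0) (r N : ℕ) :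
    dualValue q (r + 1) N = dualValue q r N * ((1 - q ^ (4 * r + 5)) *
      ((1 - q ^ (4 * (r + N) + 3)) * (q ^ (4 * N) - q ^ (4 * r + 1))) /
      ((1 - q ^ (4 * r + 1)) * ((1 - q ^ (4 * (r + N) + 5)) * (q ^ (4 * N) - q ^ (4 * r + 3))))) := by
  rw [dualValue, dualValue, prod_range_succ, show 4 * (r + 1) + 1 = 4 * r + 5 by ring]
  have := h1 (4 * r + 1) (by omega)
  generalize 1 - q ^ (4 * r + 1) = z at *
  field_simp

private theorem dualValue_succ_right (hq : q ≠ 0) (h1 : ∀ j, 0 < j → 1 - q ^ j ≠ 0) (r N : ℕ) :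
    dualValue q r (N + 1) * ((1 - q ^ (4 * N + 1)) *
        ((1 - q ^ (4 * (N + r) + 5)) * (q ^ (4 * r) - q ^ (4 * N + 3)))) =
      dualValue q r N * ((1 - q ^ (4 * N + 5)) *
        ((1 - q ^ (4 * (N + r) + 3)) * (q ^ (4 * r) - q ^ (4 * N + 1)))) := by
  induction r with
  | zero =>
    simp only [dualValue, mul_zero, add_zero, range_zero, prod_empty, pow_zero, zero_add]
    ring
  | succ r ih =>
    rw [dualValue_succ_left h1, dualValue_succ_left h1]
    have e1 := h1 (4 * (N + r) + 5) (by omega)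
    have e2 : q ^ (4 * r) - q ^ (4 * N + 3) ≠ 0 := pow_sub_pow_ne_zero hq h1 (by omega)
    have e3 := h1 (4 * N + 1) (by omega)
    have ih' := eq_div_of_mul_eq (mul_ne_zero e3 (mul_ne_zero e1 e2)) ih
    rw [ih']
    have e4 := h1 (4 * r + 1) (by omega)
    have e5 := h1 (4 * (N + r) + 9) (by omega)
    have e6 : q ^ (4 * (N + 1)) - q ^ (4 * r + 3) ≠ 0 := pow_sub_pow_ne_zero hq h1 (by omega)
    have e7 : q ^ (4 * N) - q ^ (4 * r + 3) ≠ 0 := pow_sub_pow_ne_zero hq h1 (by omega)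
    have x1 : 4 * (r + (N + 1)) + 5 = 4 * (N + r) + 9 := by ring
    have x2 : 4 * (r + N) + 5 = 4 * (N + r) + 5 := by ring
    have x3 : 4 * (N + (r + 1)) + 5 = 4 * (N + r) + 9 := by ring
    have x4 : 4 * (N + (r + 1)) + 3 = 4 * (N + r) + 7 := by ring
    have x5 : 4 * (r + (N + 1)) + 3 = 4 * (N + r) + 7 := by ring
    have x6 : 4 * (r + N) + 3 = 4 * (N + r) + 3 := by ring
    rw [x1, x2, x3, x4, x5, x6]
    have y1 : q ^ (4 * (r + 1)) - q ^ (4 * N + 3) = -q ^ 3 * (q ^ (4 * N) - q ^ (4 * r + 1)) := by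
      ring
    have y2 : q ^ (4 * (r + 1)) - q ^ (4 * N + 1) = -q * (q ^ (4 * N) - q ^ (4 * r + 3)) := by
      ring
    have y3 : q ^ (4 * (N + 1)) - q ^ (4 * r + 1) = -q * (q ^ (4 * r) - q ^ (4 * N + 3)) := by
      ring
    have y4 : q ^ (4 * (N + 1)) - q ^ (4 * r + 3) = -q ^ 3 * (q ^ (4 * r) - q ^ (4 * N + 1)) := by
      ring
    rw [y4] at e6
    rw [y1, y2, y3, y4]
    have e8 := right_ne_zero_of_mul e6
    generalize q ^ (4 * r) - q ^ (4 * N + 1) = z1 at *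
    generalize q ^ (4 * r) - q ^ (4 * N + 3) = z2 at *
    generalize q ^ (4 * N) - q ^ (4 * r + 1) = z3 at *
    generalize q ^ (4 * N) - q ^ (4 * r + 3) = z4 at *
    generalize 1 - q ^ (4 * (N + r) + 9) = z5 at *
    generalize 1 - q ^ (4 * (N + r) + 5) = z6 at *
    generalize 1 - q ^ (4 * r + 1) = z7 at *
    generalize 1 - q ^ (4 * N + 1) = z8 at *
    field_simp

private theorem dualValue_symm (hq : q ≠ 0) (h1 : ∀ j, 0 < j → 1 - q ^ j ≠ 0) (r N : ℕ) :
    dualValue q r N = dualValue q N r := by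
  induction N with
  | zero =>
    induction r with
    | zero => rfl
    | succ r ih =>
      have ih' : dualValue q r 0 = 1 - q := by rw [ih]; simp [dualValue]
      rw [dualValue_succ_left h1, ih']
      simp only [dualValue, mul_zero, range_zero, prod_empty, add_zero, zero_add, pow_one, mul_one,
        pow_zero]
      have e1 := h1 (4 * r + 1) (by omega)
      have e3 := h1 (4 * r + 3) (by omega)
      have e5 := h1 (4 * r + 5) (by omega)
      field_simp
  | succ N ih =>
    have e1 := h1 (4 * (N + r) + 5) (by omega)
    have e2 : q ^ (4 * r) - q ^ (4 * N + 3) ≠ 0 := pow_sub_pow_ne_zero hq h1 (by omega)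
    have e3 := h1 (4 * N + 1) (by omega)
    rw [dualValue_succ_left h1, ← mul_div_assoc,
      eq_div_iff (mul_ne_zero e3 (mul_ne_zero e1 e2)), dualValue_succ_right hq h1, ih]

private theorem mul_prod_eq_dualValue (hq : q ≠ 0) {V : F} {N : ℕ}
    (hV : V * q ^ (4 * N + 1) = 1 + q ^ (2 * (4 * N + 1))) (r : ℕ) :
    (1 - q ^ (4 * r + 1)) *
        ∏ j ∈ range r, quadFactor q V (4 * j + 2) / quadFactor q V (4 * j + 4) =
      dualValue q r N := by
  rw [dualValue]
  congr 1
  refine prod_congr rfl fun j _ => ?_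
  have h0 : q ^ (4 * N + 1) ≠ 0 := pow_ne_zero _ hq
  rw [eq_div_of_mul_eq h0 (quadFactor_mul_pow hV (4 * j + 2)),
    eq_div_of_mul_eq h0 (quadFactor_mul_pow hV (4 * j + 4)),
    show 4 * j + 2 + (4 * N + 1) = 4 * (j + N) + 3 by ring,
    show 4 * j + 4 + (4 * N + 1) = 4 * (j + N) + 5 by ring,
    show q ^ (4 * N + 1) - q ^ (4 * j + 2) = q * (q ^ (4 * N) - q ^ (4 * j + 1)) by ring,
    show q ^ (4 * N + 1) - q ^ (4 * j + 4) = q * (q ^ (4 * N) - q ^ (4 * j + 3)) by ring,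
    div_div_div_cancel_right₀ h0, mul_left_comm, mul_left_comm _ q, mul_div_mul_left _ _ hq]

private theorem clearedSum_of_both_special (hq : q ≠ 0) (h1 : ∀ j, 0 < j → 1 - q ^ j ≠ 0)
    {U V : F} {r N : ℕ} (hrN : 2 * r ≤ N)
    (hU : U * q ^ (4 * r + 1) = 1 + q ^ (2 * (4 * r + 1)))
    (hV : V * q ^ (4 * N + 1) = 1 + q ^ (2 * (4 * N + 1))) :
    clearedSum q U V (2 * r) * ∏ j ∈ range r, quadFactor q V (4 * j + 4) =
      (1 - q ^ (4 * r + 1)) * (∏ j ∈ range r, quadFactor q V (4 * j + 2)) *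
        ∏ i ∈ range (2 * r), denFactor q U V i := by
  have hU4 : ∀ j, quadFactor q U (4 * j + 4) ≠ 0 := fun j =>
    quadFactor_ne_zero hq h1 hU (by omega) (by omega)
  have hV4 : ∏ j ∈ range r, quadFactor q V (4 * j + 4) ≠ 0 :=
    prod_ne_zero_iff.mpr fun j _ => quadFactor_ne_zero hq h1 hV (by omega) (by omega)
  have key := sum_of_right_special hq h1 le_rfl hU4 hV
  rw [mul_prod_eq_dualValue hq hU, dualValue_symm hq h1, ← mul_prod_eq_dualValue hq hV] at key
  rw [← sum_subset (range_subset_range.mpr (by omega : 2 * r + 1 ≤ N + 1))] at key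
  · rw [clearedSum_eq_mul_sum fun i _ => denFactor_ne_zero_of_right_special hq h1 hU4 hV i, key,
      prod_div_distrib]
    field_simp
  · intro k _ hk
    have hrk : 2 * r ∈ range k := by
      rw [mem_range] at hk ⊢; omega
    have : numFactor q U V (2 * r) = 0 := by
      have := quadFactor_mul_pow hU (2 * (2 * r) + 1)
      rw [show 2 * (2 * r) + 1 = 4 * r + 1 by ring, sub_self, mul_zero] at this
      rw [numFactor, show 2 * (2 * r) + 1 = 4 * r + 1 by ring,
        (mul_eq_zero.mp this).resolve_right (pow_ne_zero _ hq)]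
      ring
    rw [prod_eq_zero hrk (by rw [this, zero_div]), mul_zero]

theorem Polynomial.eq_of_forall_eval_eq_of_injective {f g : Polynomial F} {v : ℕ → F}
    (hv : Function.Injective v) (h : ∀ i, f.eval (v i) = g.eval (v i)) : f = g :=
  Polynomial.eq_of_infinite_eval_eq f g
    ((Set.infinite_range_of_injective hv).mono (by rintro _ ⟨i, rfl⟩; exact h i))

theorem clearedSum_of_left_special (hq : q ≠ 0) (h1 : ∀ j, 0 < j → 1 - q ^ j ≠ 0)
    {U : F} {r : ℕ} (hU : U * q ^ (4 * r + 1) = 1 + q ^ (2 * (4 * r + 1))) (V : F) :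
    clearedSum q U V (2 * r) * ∏ j ∈ range r, quadFactor q V (4 * j + 4) =
      (1 - q ^ (4 * r + 1)) * (∏ j ∈ range r, quadFactor q V (4 * j + 2)) *
        ∏ i ∈ range (2 * r), denFactor q U V i := by
  let c : F →+* Polynomial F := Polynomial.C
  have key : clearedSum (c q) (c U) Polynomial.X (2 * r) *
        ∏ j ∈ range r, quadFactor (c q) Polynomial.X (4 * j + 4) =
      (1 - c q ^ (4 * r + 1)) * (∏ j ∈ range r, quadFactor (c q) Polynomial.X (4 * j + 2)) *
        ∏ i ∈ range (2 * r), denFactor (c q) (c U) Polynomial.X i := by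
    refine Polynomial.eq_of_forall_eval_eq_of_injective
      (v := fun i => (1 + q ^ (2 * (4 * (i + 2 * r) + 1))) / q ^ (4 * (i + 2 * r) + 1)) ?_ ?_
    · intro i j hij
      by_contra hne
      have a0 : q ^ (4 * (i + 2 * r) + 1) ≠ 0 := pow_ne_zero _ hq
      have b0 : q ^ (4 * (j + 2 * r) + 1) ≠ 0 := pow_ne_zero _ hq
      have := (div_eq_div_iff a0 b0).mp hij
      have h : (q ^ (4 * (i + 2 * r) + 1) - q ^ (4 * (j + 2 * r) + 1)) *
          (1 - q ^ (4 * (i + 2 * r) + 1 + (4 * (j + 2 * r) + 1))) = 0 := by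
        rw [pow_add q (4 * (i + 2 * r) + 1)]
        rw [mul_comm 2, pow_mul, mul_comm 2, pow_mul] at this
        linear_combination -this
      exact mul_ne_zero (pow_sub_pow_ne_zero hq h1 (by omega)) (h1 _ (by omega)) h
    · intro i
      have := clearedSum_of_both_special hq h1 (V := (1 + q ^ (2 * (4 * (i + 2 * r) + 1))) /
        q ^ (4 * (i + 2 * r) + 1)) (by omega : 2 * r ≤ i + 2 * r) hU
        (div_mul_cancel₀ _ (pow_ne_zero _ hq))
      simp only [← Polynomial.coe_evalRingHom, map_mul, map_prod, map_clearedSum, map_quadFactor,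
        map_denFactor, map_sub, map_one, map_pow]
      simpa [c] using this
  have := congrArg (Polynomial.evalRingHom V) key
  simp only [map_mul, map_prod, map_clearedSum, map_quadFactor,
        map_denFactor, map_sub, map_one, map_pow] at this
  simpa [c] using this

end Symmetry

theorem eval_clearedLeft {A : Type*} [CommRing A] (q x : A) (m k : ℕ) :
    (clearedLeft (Polynomial.C q) Polynomial.X m k).eval x = clearedLeft q x m k := by
  simpa using map_clearedLeft (Polynomial.evalRingHom x) (Polynomial.C q) Polynomial.X m k

theorem eval_clearedRight {A : Type*} [CommRing A] (q x : A) (m k : ℕ) :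
    (clearedRight (Polynomial.C q) Polynomial.X m k).eval x = clearedRight q x m k := by
  simpa using map_clearedRight (Polynomial.evalRingHom x) (Polynomial.C q) Polynomial.X m k

section RootOfUnity

open Complex Filter Topology

variable {ζ : ℂ} {m : ℕ}

private theorem imaginary_mul_pow_ne (hζ : ζ ^ (2 * m + 1) = 1) {ρ t : ℝ} (hρ : ρ ≠ 0)
    (ht : t ≠ 0) (a b : ℕ) : I * t * (ρ * ζ) ^ b ≠ (ρ * ζ) ^ a := by
  intro h
  have hp : ∀ c, ((ρ * ζ) ^ c) ^ (2 * m + 1) = (((ρ ^ c) ^ (2 * m + 1) : ℝ) : ℂ) := by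
    intro c
    rw [mul_pow, mul_pow, pow_right_comm ζ, hζ, one_pow, mul_one]
    push_cast
    rfl
  have hI : I ^ (2 * m + 1) = (((-1) ^ m : ℝ) : ℂ) * I := by
    rw [pow_succ, pow_mul, I_sq]
    push_cast
    rfl
  have h2 : ((((-1) ^ m * t ^ (2 * m + 1) * (ρ ^ b) ^ (2 * m + 1) : ℝ) : ℂ) * I).im =
      ((((ρ ^ a) ^ (2 * m + 1) : ℝ) : ℂ)).im := by
    rw [← hp a, ← h, mul_pow, mul_pow, hp, hI]
    push_cast
    ring_nf
  rw [im_ofReal_mul, I_im, mul_one, ofReal_im] at h2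
  exact mul_ne_zero (mul_ne_zero (by positivity) (pow_ne_zero _ ht))
    (pow_ne_zero _ (pow_ne_zero _ hρ)) h2

private theorem quadFactor_mul_self {F : Type*} [Field F] (q : F) {x : F} (hx : x ≠ 0) (a : ℕ) :
    x * quadFactor q (x + x⁻¹) a = (1 - x * q ^ a) * (x - q ^ a) := by
  rw [quadFactor]
  field_simp
  ring

private theorem quadFactor_imaginary_ne (hζ : ζ ^ (2 * m + 1) = 1) {ρ s : ℝ} (hρ : ρ ≠ 0)
    (hs : s ≠ 0) (a : ℕ) : quadFactor (ρ * ζ) (I * s + (I * s)⁻¹) a ≠ 0 := by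
  intro h
  have hs' : I * (s : ℂ) ≠ 0 := mul_ne_zero I_ne_zero (by exact_mod_cast hs)
  have := quadFactor_mul_self (ρ * ζ) hs' a
  rw [h, mul_zero] at this
  rcases mul_eq_zero.mp this.symm with h0 | h0
  · refine imaginary_mul_pow_ne hζ hρ hs 0 a ?_
    rw [pow_zero]
    linear_combination -h0
  · refine imaginary_mul_pow_ne hζ hρ hs a 0 ?_
    rw [pow_zero]
    linear_combination h0

private theorem quadFactor_imaginary_ne' (hζ : ζ ^ (2 * m + 1) = 1) {s : ℝ} (hs : s ≠ 0) (a : ℕ) :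
    quadFactor ζ (I * s + (I * s)⁻¹) a ≠ 0 := by
  have := quadFactor_imaginary_ne hζ one_ne_zero hs a
  rwa [ofReal_one, one_mul] at this

private theorem one_sub_pow_ne_zero (hζ : IsPrimitiveRoot ζ (2 * m + 1)) {j : ℕ}
    (hj : ¬ (2 * m + 1) ∣ j) : 1 - ζ ^ j ≠ 0 := fun h =>
  hj ((hζ.pow_eq_one_iff_dvd j).mp (sub_eq_zero.mp h).symm)

private theorem one_sub_pow_four_ne_zero (hζ : IsPrimitiveRoot ζ (2 * m + 1)) {i : ℕ} (hi : i < m) :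
    1 - ζ ^ (4 * i + 4) ≠ 0 := by
  refine one_sub_pow_ne_zero hζ fun h => ?_
  have hc : Nat.Coprime (2 * m + 1) 4 := by
    rw [show 4 = 2 ^ 2 by norm_num]
    exact Nat.Coprime.pow_right _ (Nat.coprime_two_right.mpr (by simp))
  rw [show 4 * i + 4 = 4 * (i + 1) by ring] at h
  have := Nat.le_of_dvd (by omega) (hc.dvd_of_dvd_mul_left h)
  omega

private theorem rahman_at_rootOfUnity (hm : 0 < m) (hζ : IsPrimitiveRoot ζ (2 * m + 1)) {s t : ℝ}
    (hs : s ≠ 0) (ht : t ≠ 0) :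
    ∑ k ∈ range (m + 1), (1 - ζ ^ (6 * k + 1)) * ζ ^ (2 * k) *
      ∏ i ∈ range k, rahmanRatio ζ (I * s + (I * s)⁻¹) (I * t) (ζ ^ (4 * m)) i = 0 := by
  set U : ℂ := I * s + (I * s)⁻¹ with hU
  set y : ℂ := I * t with hy
  have hζd := hζ.pow_eq_one
  have hval : rahmanValue ζ U y m = 0 := by
    rw [rahmanValue]
    obtain ⟨j, hj, h⟩ : ∃ j < m, 4 * j + 3 = 2 * m + 1 ∨ 4 * j + 5 = 2 * m + 1 := by
      rcases Nat.even_or_odd' m with ⟨c, rfl | rfl⟩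
      · exact ⟨c - 1, by omega, by omega⟩
      · exact ⟨c, by omega, by omega⟩
    rw [prod_eq_zero (mem_range.mpr hj), mul_zero]
    rcases h with h | h <;> rw [h, hζd] <;> ring
  let f : ℝ → ℂ := fun ρ => ∑ k ∈ range (m + 1), (1 - (ρ * ζ) ^ (6 * k + 1)) * (ρ * ζ) ^ (2 * k) *
      ∏ i ∈ range k, rahmanRatio (ρ * ζ) U y ((ρ * ζ) ^ (4 * m)) i
  let g : ℝ → ℂ := fun ρ => rahmanValue (ρ * ζ) U y m
  have hE : ∀ a, quadFactor ζ U a ≠ 0 := quadFactor_imaginary_ne' hζd hs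
  have hY : ∀ a b, y * ζ ^ b - ζ ^ a ≠ 0 := fun a b => by
    simpa [sub_eq_zero] using imaginary_mul_pow_ne hζd one_ne_zero ht a b
  have hY0 : ∀ a, y - ζ ^ a ≠ 0 := fun a => by simpa using hY a 0
  have hf : ContinuousAt f 1 := by
    refine tendsto_finsetSum _ fun k hk => ContinuousAt.mul (by fun_prop) ?_
    refine tendsto_finsetProd _ fun i hi => ?_
    have him : i < m := by rw [mem_range] at hk hi; omega
    simp only [rahmanRatio]
    refine ContinuousAt.div (by unfold quadFactor; fun_prop) (by unfold quadFactor; fun_prop) ?_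
    simp only [ofReal_one, one_mul]
    refine mul_ne_zero (mul_ne_zero (mul_ne_zero (mul_ne_zero ?_ (hE _)) (hY0 _)) ?_) ?_
    · exact one_sub_pow_four_ne_zero hζ him
    · rw [← neg_sub]
      exact neg_ne_zero.mpr (hY _ _)
    · rw [← pow_add, show 4 * m + (2 * i + 3) = (2 * m + 1) * 2 + (2 * i + 1) by ring, pow_add,
        pow_mul, hζd, one_pow, one_mul]
      exact one_sub_pow_ne_zero hζ (Nat.not_dvd_of_pos_of_lt (by omega) (by omega))
  have hg : ContinuousAt g 1 := by
    simp only [g, rahmanValue]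
    refine ContinuousAt.mul (by fun_prop) (tendsto_finsetProd _ fun i hi => ?_)
    refine ContinuousAt.div (by fun_prop) (by unfold quadFactor; fun_prop) ?_
    simp only [ofReal_one, one_mul]
    exact mul_ne_zero (mul_ne_zero (hY0 _) (hY0 _)) (hE _)
  have hfg : f =ᶠ[𝓝[<] 1] g := by
    filter_upwards [Ioo_mem_nhdsLT (zero_lt_one' ℝ)] with ρ hρ
    have hρ0 : ρ ≠ 0 := hρ.1.ne'
    have hq : (ρ : ℂ) * ζ ≠ 0 :=
      mul_ne_zero (by exact_mod_cast hρ0) (hζ.ne_zero (by omega))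
    refine rahman_terminating hq ?_ (fun j => quadFactor_imaginary_ne hζd hρ0 hs _) ?_ ?_ ?_ m
    · intro j hj h
      have h' := congrArg norm (sub_eq_zero.mp h)
      rw [norm_pow, norm_mul, hζ.norm'_eq_one (by omega), norm_real, Real.norm_of_nonneg hρ.1.le,
        mul_one, norm_one] at h'
      exact (pow_lt_one₀ hρ.1.le hρ.2 hj.ne').ne h'.symm
    · intro j h
      exact imaginary_mul_pow_ne hζd hρ0 ht (2 * j + 2) 0 (by rw [pow_zero]; linear_combination h)
    · intro i j h
      exact imaginary_mul_pow_ne hζd hρ0 ht (4 * i) (2 * j) (by linear_combination -h)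
    · intro j h
      exact imaginary_mul_pow_ne hζd hρ0 ht (4 * j + 3) 0 (by rw [pow_zero]; linear_combination h)
  have := tendsto_nhds_unique_of_eventuallyEq
    (hf.tendsto.mono_left nhdsWithin_le_nhds) (hg.tendsto.mono_left nhdsWithin_le_nhds) hfg
  simpa [f, g, hval] using this

private theorem clearedSum_imaginary (hm : 0 < m) (hζ : IsPrimitiveRoot ζ (2 * m + 1)) {s t : ℝ}
    (hs : s ≠ 0) (ht : t ≠ 0) :
    clearedSum ζ (I * s + (I * s)⁻¹) (I * t + (I * t)⁻¹) m = 0 := by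
  have hζd := hζ.pow_eq_one
  rw [clearedSum_eq_mul_sum fun i hi => mul_ne_zero (mul_ne_zero (quadFactor_imaginary_ne' hζd hs _) (quadFactor_imaginary_ne' hζd ht _)) (one_sub_pow_four_ne_zero hζ hi)]
  convert mul_zero _
  rw [← rahman_at_rootOfUnity hm hζ hs ht]
  refine sum_congr rfl fun k hk => ?_
  congr 1
  refine prod_congr rfl fun i hi => ?_
  have him : i < m := by rw [mem_range] at hk hi; omega
  have ht' : I * (t : ℂ) ≠ 0 := mul_ne_zero I_ne_zero (by exact_mod_cast ht)
  have v1 := quadFactor_mul_self ζ ht' (4 * i + 1)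
  have v2 := quadFactor_mul_self ζ ht' (2 * i + 2)
  have w1 := quadFactor_imaginary_ne' hζd hs (4 * i + 4)
  have w2 := quadFactor_imaginary_ne' hζd ht (2 * i + 2)
  have w3 := one_sub_pow_four_ne_zero hζ him
  have w4 : 1 - ζ ^ (2 * i + 1) ≠ 0 :=
    one_sub_pow_ne_zero hζ (Nat.not_dvd_of_pos_of_lt (by omega) (by omega))
  have hT : ζ ^ (4 * m) * ζ ^ 2 = 1 := by
    rw [← pow_add, show 4 * m + 2 = (2 * m + 1) * 2 by ring, pow_mul, hζd, one_pow]
  have hT0 : ζ ^ (4 * m) ≠ 0 := left_ne_zero_of_mul_eq_one hT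
  rw [numFactor, denFactor, rahmanRatio]
  generalize quadFactor ζ (I * s + (I * s)⁻¹) (4 * i + 4) = e1 at *
  generalize quadFactor ζ (I * s + (I * s)⁻¹) (2 * i + 1) = e2 at *
  generalize quadFactor ζ (I * t + (I * t)⁻¹) (4 * i + 1) = e3 at *
  generalize quadFactor ζ (I * t + (I * t)⁻¹) (2 * i + 2) = e4 at *
  generalize I * (t : ℂ) = y at *
  generalize ζ ^ (4 * m) = T at *
  have x1 : T * ζ ^ (4 * i + 3) = ζ ^ (4 * i + 1) := by linear_combination ζ ^ (4 * i + 1) * hT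
  have x2 : T - ζ ^ (4 * i) = T * (1 - ζ ^ (4 * i + 2)) := by
    linear_combination ζ ^ (4 * i) * hT
  have x3 : T - y * ζ ^ (2 * i) = T * (1 - y * ζ ^ (2 * i + 2)) := by
    linear_combination y * ζ ^ (2 * i) * hT
  have x4 : 1 - T * ζ ^ (2 * i + 3) = 1 - ζ ^ (2 * i + 1) := by
    linear_combination -ζ ^ (2 * i + 1) * hT
  have nz := mul_ne_zero ht' w2
  rw [v2] at nz
  rw [x1, x2, x3, x4]
  have n1 := left_ne_zero_of_mul nz
  have n2 := right_ne_zero_of_mul nz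
  generalize 1 - ζ ^ (2 * i + 1) = f1 at *
  generalize 1 - ζ ^ (4 * i + 4) = f2 at *
  generalize 1 - ζ ^ (4 * i + 2) = f3 at *
  rw [div_eq_div_iff (by positivity) (by positivity)]
  linear_combination (e2 * f3 * f2 * e1 * T * f1) * (e4 * v1 - e3 * v2)

private theorem sum_C_mul_eq_zero {F ι : Type*} [Field F] {v : ℕ → F} (hv : Function.Injective v)
    {t : Finset ι} {c : ι → F} {p : ι → Polynomial F}
    (h : ∀ i, ∑ k ∈ t, c k * (p k).eval (v i) = 0) : ∑ k ∈ t, Polynomial.C (c k) * p k = 0 := by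
  refine Polynomial.eq_of_forall_eval_eq_of_injective hv fun i => ?_
  simpa [Polynomial.eval_finsetSum] using h i

private theorem imaginary_injective :
    Function.Injective fun i : ℕ => I * ((i + 1 : ℝ) : ℂ) + (I * ((i + 1 : ℝ) : ℂ))⁻¹ := by
  intro i j hij
  have hi : (0 : ℝ) < i + 1 := by positivity
  have hj : (0 : ℝ) < j + 1 := by positivity
  have key : ∀ s : ℝ, (I * (s : ℂ) + (I * (s : ℂ))⁻¹).im = s - s⁻¹ := by
    intro s
    have : I * (s : ℂ) + (I * (s : ℂ))⁻¹ = ((s - s⁻¹ : ℝ) : ℂ) * I := by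
      rw [mul_inv, inv_I]
      push_cast
      ring
    rw [this, im_ofReal_mul, I_im, mul_one]
  have h := congrArg im hij
  simp only [key] at h
  have h2 : ((i : ℝ) - j) * (1 + (i + 1) * (j + 1)) = 0 := by
    field_simp at h
    linear_combination h
  have h3 := (mul_eq_zero.mp h2).resolve_right (by positivity)
  exact_mod_cast sub_eq_zero.mp h3

theorem clearedSum_of_isPrimitiveRoot (hm : 0 < m) (hζ : IsPrimitiveRoot ζ (2 * m + 1))
    (U V : ℂ) : clearedSum ζ U V m = 0 := by
  have h1 : ∀ j : ℕ, clearedSum ζ U (I * ((j + 1 : ℝ) : ℂ) + (I * ((j + 1 : ℝ) : ℂ))⁻¹) m = 0 := by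
    intro j
    have := sum_C_mul_eq_zero imaginary_injective (t := range (m + 1))
      (c := fun k => clearedCoeff ζ m k *
        clearedRight ζ (I * ((j + 1 : ℝ) : ℂ) + (I * ((j + 1 : ℝ) : ℂ))⁻¹) m k)
      (p := fun k => clearedLeft (Polynomial.C ζ) Polynomial.X m k) fun i => by
        rw [← clearedSum_imaginary hm hζ (s := i + 1) (t := j + 1) (by positivity)
          (by positivity), clearedSum]
        exact sum_congr rfl fun k _ => by rw [eval_clearedLeft]; ring
    have := congrArg (Polynomial.eval U) this
    rw [Polynomial.eval_finsetSum, Polynomial.eval_zero] at this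
    rw [← this, clearedSum]
    refine sum_congr rfl fun k _ => ?_
    rw [Polynomial.eval_mul, Polynomial.eval_C, eval_clearedLeft]
    ring
  have := sum_C_mul_eq_zero imaginary_injective (t := range (m + 1))
    (c := fun k => clearedCoeff ζ m k * clearedLeft ζ U m k)
    (p := fun k => clearedRight (Polynomial.C ζ) Polynomial.X m k) fun i => by
      rw [← h1 i, clearedSum]
      exact sum_congr rfl fun k _ => by rw [eval_clearedRight]
  have := congrArg (Polynomial.eval V) this
  rw [Polynomial.eval_finsetSum, Polynomial.eval_zero] at this
  rw [← this, clearedSum]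
  exact sum_congr rfl fun k _ => by rw [Polynomial.eval_mul, Polynomial.eval_C, eval_clearedRight]

theorem sum_derivative_of_isPrimitiveRoot (hm : 0 < m) (hζ : IsPrimitiveRoot ζ (2 * m + 1))
    (U V : ℂ) :
    ∑ k ∈ range (m + 1), clearedCoeff ζ m k *
      (clearedLeft (Polynomial.C ζ) Polynomial.X m k).derivative.eval U *
      (clearedRight (Polynomial.C ζ) Polynomial.X m k).derivative.eval V = 0 := by
  have hinj : Function.Injective (Nat.cast : ℕ → ℂ) := Nat.cast_injective
  have h1 : ∀ v : ℂ, ∑ k ∈ range (m + 1), clearedCoeff ζ m k * clearedRight ζ v m k *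
      (clearedLeft (Polynomial.C ζ) Polynomial.X m k).derivative.eval U = 0 := by
    intro v
    have := sum_C_mul_eq_zero hinj (t := range (m + 1))
      (c := fun k => clearedCoeff ζ m k * clearedRight ζ v m k)
      (p := fun k => clearedLeft (Polynomial.C ζ) Polynomial.X m k) fun i => by
        rw [← clearedSum_of_isPrimitiveRoot hm hζ i v, clearedSum]
        exact sum_congr rfl fun k _ => by rw [eval_clearedLeft]; ring
    have := congrArg (fun p => (Polynomial.derivative p).eval U) this
    simpa only [Polynomial.derivative_sum, Polynomial.derivative_C_mul,
      Polynomial.eval_finsetSum, Polynomial.eval_mul, Polynomial.eval_C, Polynomial.derivative_zero,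
      Polynomial.eval_zero] using this
  have := sum_C_mul_eq_zero hinj (t := range (m + 1))
    (c := fun k => clearedCoeff ζ m k *
      (clearedLeft (Polynomial.C ζ) Polynomial.X m k).derivative.eval U)
    (p := fun k => clearedRight (Polynomial.C ζ) Polynomial.X m k) fun i => by
      rw [← h1 i]
      exact sum_congr rfl fun k _ => by rw [eval_clearedRight]; ring
  have := congrArg (fun p => (Polynomial.derivative p).eval V) this
  simpa only [Polynomial.derivative_sum, Polynomial.derivative_C_mul,
    Polynomial.eval_finsetSum, Polynomial.eval_mul, Polynomial.eval_C, Polynomial.derivative_zero,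
    Polynomial.eval_zero] using this

end RootOfUnity

/-- The ring `O`, embedded in `K` by `ι`, is local with residue map `ev`; its maximal ideal is
generated by `1 - q ^ d`, and `q` reduces to a primitive `d`-th root of unity. -/
structure IsLocalModel {O K : Type*} [CommRing O] [Field K] (ι : O →+* K) (ev : O →+* ℂ) (q : O)
    (d : ℕ) : Prop where
  injective : Function.Injective ι
  isUnit : ∀ f, ev f ≠ 0 → IsUnit f
  dvd : ∀ f, ev f = 0 → 1 - q ^ d ∣ f
  primitive : IsPrimitiveRoot (ev q) d
  one_sub_ne : ∀ j, 0 < j → 1 - q ^ j ≠ 0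

/-- The element `x` of `K` lies in `O` and reduces to `z`. -/
def HasValue {O K : Type*} [CommRing O] [Field K] (ι : O →+* K) (ev : O →+* ℂ) (x : K) (z : ℂ) :
    Prop :=
  ∃ f, ι f = x ∧ ev f = z

namespace HasValue

variable {O K : Type*} [CommRing O] [Field K] {ι : O →+* K} {ev : O →+* ℂ} {x y : K} {z w : ℂ}

theorem of (f : O) : HasValue ι ev (ι f) (ev f) := ⟨f, rfl, rfl⟩

theorem one : HasValue ι ev 1 1 := ⟨1, map_one _, map_one _⟩

theorem zero : HasValue ι ev 0 0 := ⟨0, map_zero _, map_zero _⟩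

theorem add (hx : HasValue ι ev x z) (hy : HasValue ι ev y w) : HasValue ι ev (x + y) (z + w) := by
  obtain ⟨f, rfl, rfl⟩ := hx
  obtain ⟨g, rfl, rfl⟩ := hy
  exact ⟨f + g, map_add _ _ _, map_add _ _ _⟩

theorem sub (hx : HasValue ι ev x z) (hy : HasValue ι ev y w) : HasValue ι ev (x - y) (z - w) := by
  obtain ⟨f, rfl, rfl⟩ := hx
  obtain ⟨g, rfl, rfl⟩ := hy
  exact ⟨f - g, map_sub _ _ _, map_sub _ _ _⟩

theorem mul (hx : HasValue ι ev x z) (hy : HasValue ι ev y w) : HasValue ι ev (x * y) (z * w) := by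
  obtain ⟨f, rfl, rfl⟩ := hx
  obtain ⟨g, rfl, rfl⟩ := hy
  exact ⟨f * g, map_mul _ _ _, map_mul _ _ _⟩

theorem pow (hx : HasValue ι ev x z) (n : ℕ) : HasValue ι ev (x ^ n) (z ^ n) := by
  obtain ⟨f, rfl, rfl⟩ := hx
  exact ⟨f ^ n, map_pow _ _ _, map_pow _ _ _⟩

theorem sum {α : Type*} {s : Finset α} {f : α → K} {g : α → ℂ}
    (h : ∀ i ∈ s, HasValue ι ev (f i) (g i)) :
    HasValue ι ev (∑ i ∈ s, f i) (∑ i ∈ s, g i) := by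
  classical
  induction s using Finset.induction_on with
  | empty => simpa using zero
  | insert a s ha ih =>
    rw [sum_insert ha, sum_insert ha]
    exact (h a (mem_insert_self a s)).add (ih fun i hi => h i (mem_insert_of_mem hi))

theorem prod {α : Type*} {s : Finset α} {f : α → K} {g : α → ℂ}
    (h : ∀ i ∈ s, HasValue ι ev (f i) (g i)) :
    HasValue ι ev (∏ i ∈ s, f i) (∏ i ∈ s, g i) := by
  classical
  induction s using Finset.induction_on with
  | empty => simpa using one
  | insert a s ha ih =>
    rw [prod_insert ha, prod_insert ha]
    exact (h a (mem_insert_self a s)).mul (ih fun i hi => h i (mem_insert_of_mem hi))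

theorem div {q : O} {d : ℕ} (h : IsLocalModel ι ev q d) (hx : HasValue ι ev x z)
    (hy : HasValue ι ev y w) (hw : w ≠ 0) : HasValue ι ev (x / y) (z / w) := by
  obtain ⟨f, rfl, rfl⟩ := hx
  obtain ⟨g, rfl, rfl⟩ := hy
  obtain ⟨u, rfl⟩ := h.isUnit g hw
  refine ⟨f * ↑u⁻¹, ?_, ?_⟩
  · have hu : ι (u : O) * ι (↑u⁻¹ : O) = 1 := by rw [← map_mul, Units.mul_inv, map_one]
    rw [map_mul, eq_div_iff (left_ne_zero_of_mul_eq_one hu), mul_assoc, mul_comm (ι ↑u⁻¹), hu, mul_one]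
  · have hu : ev (u : O) * ev (↑u⁻¹ : O) = 1 := by rw [← map_mul, Units.mul_inv, map_one]
    rw [map_mul, eq_div_iff hw, mul_assoc, mul_comm (ev ↑u⁻¹), hu, mul_one]

end HasValue

theorem quadFactor_two {A : Type*} [CommRing A] (q : A) (a : ℕ) :
    quadFactor q 2 a = (1 - q ^ a) ^ 2 := by
  rw [quadFactor]
  ring

section Periodic

variable {A : Type*} [CommRing A] {q : A} {d : ℕ}

private theorem pow_periodic (hq : q ^ d = 1) (c u i : ℕ) : q ^ (c * (u * d) + i) = q ^ i := by
  rw [show c * (u * d) + i = d * (c * u) + i by ring, pow_add, pow_mul, hq, one_pow, one_mul]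

private theorem numFactor_two_periodic (hq : q ^ d = 1) (u i : ℕ) :
    numFactor q 2 2 (u * d + i) = numFactor q 2 2 i := by
  simp only [numFactor, quadFactor_two, mul_add, add_assoc, pow_periodic hq]

private theorem denFactor_two_periodic (hq : q ^ d = 1) (u i : ℕ) :
    denFactor q 2 2 (u * d + i) = denFactor q 2 2 i := by
  simp only [denFactor, quadFactor_two, mul_add, add_assoc, pow_periodic hq]

end Periodic

section Local

variable {O K : Type*} [CommRing O] [Field K] {ι : O →+* K} {ev : O →+* ℂ} {q : O} {d : ℕ}

namespace IsLocalModel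

theorem map_one_sub_ne (h : IsLocalModel ι ev q d) {j : ℕ} (hj : 0 < j) : 1 - ι q ^ j ≠ 0 := by
  rw [← map_one ι, ← map_pow, ← map_sub]
  exact (map_ne_zero_iff ι h.injective).mpr (h.one_sub_ne j hj)

theorem hasValue_q : HasValue ι ev (ι q) (ev q) := HasValue.of q

theorem hasValue_one_sub (j : ℕ) : HasValue ι ev (1 - ι q ^ j) (1 - ev q ^ j) :=
  HasValue.one.sub (hasValue_q.pow j)

theorem ev_one_sub_ne (h : IsLocalModel ι ev q d) {j : ℕ} (hj : ¬ d ∣ j) : 1 - ev q ^ j ≠ 0 :=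
  fun h0 => hj ((h.primitive.pow_eq_one_iff_dvd j).mp (sub_eq_zero.mp h0).symm)

/-- The quotient `(1 - q ^ (d * c)) / (1 - q ^ d)` reduces to `c`. -/
theorem exists_one_sub_pow_mul (h : IsLocalModel ι ev q d) (c : ℕ) :
    ∃ x, HasValue ι ev x c ∧ 1 - ι q ^ (d * c) = (1 - ι q ^ d) * x := by
  refine ⟨∑ i ∈ range c, (ι q ^ d) ^ i, ?_, ?_⟩
  · have := HasValue.sum (ι := ι) (ev := ev) (s := range c) fun i _ =>
      ((hasValue_q (ι := ι) (ev := ev) (q := q)).pow d).pow i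
    simpa [h.primitive.pow_eq_one] using this
  · rw [mul_neg_geom_sum, pow_mul]

private theorem exists_hasValue_block (h : IsLocalModel ι ev q d) (hd : 1 < d) {α γ : ℕ}
    (hα : Nat.Coprime α d) (hγ : Nat.Coprime γ d) (β u : ℕ) : ∃ z, HasValue ι ev
      (∏ i ∈ range d, (1 - ι q ^ (α * (u * d + i) + β)) / (1 - ι q ^ (γ * (u * d + i + 1)))) z := by
  have : NeZero d := ⟨by omega⟩
  rw [prod_div_distrib]
  obtain ⟨j, hj, hdvd⟩ : ∃ j < d, d ∣ α * (u * d + j) + β := by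
    refine ⟨(-(β : ZMod d) * (α : ZMod d)⁻¹).val, ZMod.val_lt _, ?_⟩
    rw [← ZMod.natCast_eq_zero_iff]
    push_cast
    rw [ZMod.natCast_zmod_val, ZMod.natCast_self]
    linear_combination -(β : ZMod d) * ZMod.coe_mul_inv_eq_one α hα
  obtain ⟨c, hc⟩ := hdvd
  obtain ⟨x, hx, hxe⟩ := h.exists_one_sub_pow_mul c
  have hN : ∏ i ∈ range d, (1 - ι q ^ (α * (u * d + i) + β)) = (1 - ι q ^ d) *
      (x * ∏ i ∈ (range d).erase j, (1 - ι q ^ (α * (u * d + i) + β))) := by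
    rw [← mul_prod_erase _ _ (mem_range.mpr hj), hc, hxe, mul_assoc]
  obtain ⟨y, hy, hye⟩ := h.exists_one_sub_pow_mul (γ * (u + 1))
  have hD : ∏ i ∈ range d, (1 - ι q ^ (γ * (u * d + i + 1))) = (1 - ι q ^ d) *
      (y * ∏ i ∈ range (d - 1), (1 - ι q ^ (γ * (u * d + i + 1)))) := by
    have hs := prod_range_succ (fun i => 1 - ι q ^ (γ * (u * d + i + 1))) (d - 1)
    rw [Nat.sub_add_cancel hd.le] at hs
    rw [hs, show γ * (u * d + (d - 1) + 1) = d * (γ * (u + 1)) by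
      rw [add_assoc, Nat.sub_add_cancel hd.le]; ring, hye]
    ring
  rw [hN, hD, mul_div_mul_left _ _ (h.map_one_sub_ne (by omega))]
  refine ⟨_, (hx.mul (HasValue.prod fun i _ => hasValue_one_sub _)).div h
    (hy.mul (HasValue.prod fun i _ => hasValue_one_sub _)) (mul_ne_zero ?_ ?_)⟩
  · have hγ0 : γ ≠ 0 := by
      rintro rfl
      rw [Nat.coprime_zero_left] at hγ
      omega
    exact_mod_cast mul_ne_zero hγ0 (by omega)
  · refine prod_ne_zero_iff.mpr fun i hi => h.ev_one_sub_ne fun hdv => ?_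
    have h1 := hγ.symm.dvd_of_dvd_mul_left hdv
    rw [add_assoc, Nat.dvd_add_right (Dvd.intro_left u rfl)] at h1
    have := Nat.le_of_dvd (by omega) h1
    rw [mem_range] at hi
    omega

theorem exists_hasValue_prod (h : IsLocalModel ι ev q d) (hd : 1 < d) {α γ : ℕ}
    (hα : Nat.Coprime α d) (hγ : Nat.Coprime γ d) (β k : ℕ) : ∃ z, HasValue ι ev
      (∏ i ∈ range k, (1 - ι q ^ (α * i + β)) / (1 - ι q ^ (γ * (i + 1)))) z := by
  have hfull : ∀ u, ∃ z, HasValue ι ev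
      (∏ i ∈ range (u * d), (1 - ι q ^ (α * i + β)) / (1 - ι q ^ (γ * (i + 1)))) z := by
    intro u
    induction u with
    | zero => exact ⟨1, by simpa using HasValue.one⟩
    | succ u ih =>
      obtain ⟨z, hz⟩ := ih
      obtain ⟨w, hw⟩ := h.exists_hasValue_block hd hα hγ β u
      rw [add_mul, one_mul, prod_range_add]
      exact ⟨z * w, hz.mul hw⟩
  rw [← Nat.div_add_mod' k d, prod_range_add]
  obtain ⟨z, hz⟩ := hfull (k / d)
  refine ⟨_, hz.mul (HasValue.prod fun i hi =>
    (hasValue_one_sub _).div h (hasValue_one_sub _) (h.ev_one_sub_ne fun hdv => ?_))⟩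
  have h1 := hγ.symm.dvd_of_dvd_mul_left hdv
  rw [add_assoc, Nat.dvd_add_right (Dvd.intro_left _ rfl)] at h1
  have := Nat.le_of_dvd (by omega) h1
  have := Nat.mod_lt k (by omega : 0 < d)
  rw [mem_range] at hi
  omega

theorem exists_hasValue_div (h : IsLocalModel ι ev q d) {n j : ℕ} (hdn : d ∣ n) (hj : 0 < j) :
    ∃ z, HasValue ι ev ((1 - ι q ^ n) / (1 - ι q ^ j)) z := by
  by_cases hdj : d ∣ j
  · obtain ⟨b, rfl⟩ := hdn
    obtain ⟨c, rfl⟩ := hdj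
    obtain ⟨x, hx, hxe⟩ := h.exists_one_sub_pow_mul b
    obtain ⟨y, hy, hye⟩ := h.exists_one_sub_pow_mul c
    rw [hxe, hye, mul_div_mul_left _ _ (h.map_one_sub_ne (Nat.pos_of_mul_pos_right hj))]
    exact ⟨_, hx.div h hy (Nat.cast_ne_zero.mpr (Nat.pos_of_mul_pos_left hj).ne')⟩
  · exact ⟨_, (hasValue_one_sub _).div h (hasValue_one_sub _) (h.ev_one_sub_ne hdj)⟩

section Odd

variable {m : ℕ}

private theorem coprime_pow_two (m e : ℕ) : Nat.Coprime (2 ^ e) (2 * m + 1) :=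
  Nat.Coprime.pow_left _ (Nat.coprime_two_left.mpr (by simp))

theorem hasValue_numFactor (i : ℕ) :
    HasValue ι ev (numFactor (ι q) 2 2 i) (numFactor (ev q) 2 2 i) := by
  simp only [numFactor, quadFactor_two]
  exact (((hasValue_one_sub _).pow 2).mul ((hasValue_one_sub _).pow 2)).mul (hasValue_one_sub _)

theorem hasValue_denFactor (i : ℕ) :
    HasValue ι ev (denFactor (ι q) 2 2 i) (denFactor (ev q) 2 2 i) := by
  simp only [denFactor, quadFactor_two]
  exact (((hasValue_one_sub _).pow 2).mul ((hasValue_one_sub _).pow 2)).mul (hasValue_one_sub _)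

theorem ev_denFactor_ne (h : IsLocalModel ι ev q (2 * m + 1)) {i : ℕ} (hi : i < 2 * m) :
    denFactor (ev q) 2 2 i ≠ 0 := by
  have h4 : 1 - ev q ^ (4 * i + 4) ≠ 0 := h.ev_one_sub_ne fun hdv => by
    rw [show 4 * i + 4 = 2 ^ 2 * (i + 1) by ring] at hdv
    have := Nat.le_of_dvd (by omega) ((coprime_pow_two m 2).symm.dvd_of_dvd_mul_left hdv)
    omega
  have h2 : 1 - ev q ^ (2 * i + 2) ≠ 0 := h.ev_one_sub_ne fun hdv => by
    rw [show 2 * i + 2 = 2 ^ 1 * (i + 1) by ring] at hdv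
    have := Nat.le_of_dvd (by omega) ((coprime_pow_two m 1).symm.dvd_of_dvd_mul_left hdv)
    omega
  rw [denFactor, quadFactor_two, quadFactor_two]
  exact mul_ne_zero (mul_ne_zero (pow_ne_zero _ h4) (pow_ne_zero _ h2)) h4

theorem exists_hasValue_prod_ratio (h : IsLocalModel ι ev q (2 * m + 1)) (hm : 0 < m) (k : ℕ) :
    ∃ z, HasValue ι ev (∏ i ∈ range k, numFactor (ι q) 2 2 i / denFactor (ι q) 2 2 i) z := by
  obtain ⟨x, hx⟩ := h.exists_hasValue_prod (by omega) (coprime_pow_two m 1)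
    (coprime_pow_two m 1) 1 k
  obtain ⟨y, hy⟩ := h.exists_hasValue_prod (by omega) (coprime_pow_two m 2)
    (coprime_pow_two m 2) 1 k
  obtain ⟨z, hz⟩ := h.exists_hasValue_prod (by omega) (coprime_pow_two m 2)
    (coprime_pow_two m 2) 2 k
  refine ⟨x ^ 2 * y ^ 2 * z, ?_⟩
  convert ((hx.pow 2).mul (hy.pow 2)).mul hz using 1
  simp only [← prod_pow, ← prod_mul_distrib]
  refine prod_congr rfl fun i _ => ?_
  rw [numFactor, denFactor]
  simp only [quadFactor_two, pow_one, mul_add, mul_one, show 2 ^ 2 = 4 by norm_num]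
  simp only [div_pow, div_mul_div_comm]
  ring

private theorem sum_block_at_root (h : IsLocalModel ι ev q (2 * m + 1)) (hm : 0 < m) {w : ℕ}
    (hw : w = m + 1 ∨ w = 2 * m + 1) :
    ∑ v ∈ range w, (1 - ev q ^ (6 * v + 1)) * ev q ^ (2 * v) *
      ∏ i ∈ range v, numFactor (ev q) 2 2 i / denFactor (ev q) 2 2 i = 0 := by
  have h0 : ∑ v ∈ range (m + 1), (1 - ev q ^ (6 * v + 1)) * ev q ^ (2 * v) *
      ∏ i ∈ range v, numFactor (ev q) 2 2 i / denFactor (ev q) 2 2 i = 0 := by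
    have hden : ∀ i < m, denFactor (ev q) 2 2 i ≠ 0 := fun i hi => h.ev_denFactor_ne (by omega)
    have := clearedSum_of_isPrimitiveRoot hm h.primitive 2 2
    rw [clearedSum_eq_mul_sum hden] at this
    exact (mul_eq_zero.mp this).resolve_left
      (prod_ne_zero_iff.mpr fun i hi => hden i (mem_range.mp hi))
  rcases hw with rfl | rfl
  · exact h0
  · rw [← h0]
    refine (sum_subset (range_subset_range.mpr (by omega)) fun v _ hv => ?_).symm
    have hmv : m ∈ range v := by
      rw [mem_range] at hv ⊢; omega
    rw [prod_eq_zero hmv, mul_zero]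
    rw [numFactor, quadFactor_two, h.primitive.pow_eq_one]
    ring

private theorem hasValue_block (h : IsLocalModel ι ev q (2 * m + 1)) (hm : 0 < m) {w : ℕ}
    (hw : w = m + 1 ∨ w = 2 * m + 1) (u : ℕ) :
    HasValue ι ev (∑ v ∈ range w, (1 - ι q ^ (6 * (u * (2 * m + 1) + v) + 1)) *
      ι q ^ (2 * (u * (2 * m + 1) + v)) * ∏ i ∈ range (u * (2 * m + 1) + v),
        numFactor (ι q) 2 2 i / denFactor (ι q) 2 2 i) 0 := by
  obtain ⟨z, hz⟩ := h.exists_hasValue_prod_ratio hm (u * (2 * m + 1))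
  have key : HasValue ι ev ((∏ i ∈ range (u * (2 * m + 1)),
      numFactor (ι q) 2 2 i / denFactor (ι q) 2 2 i) *
      ∑ v ∈ range w, (1 - ι q ^ (6 * (u * (2 * m + 1) + v) + 1)) *
      ι q ^ (2 * (u * (2 * m + 1) + v)) * ∏ i ∈ range v,
        numFactor (ι q) 2 2 (u * (2 * m + 1) + i) / denFactor (ι q) 2 2 (u * (2 * m + 1) + i))
      (z * ∑ v ∈ range w, (1 - ev q ^ (6 * (u * (2 * m + 1) + v) + 1)) *
      ev q ^ (2 * (u * (2 * m + 1) + v)) * ∏ i ∈ range v,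
        numFactor (ev q) 2 2 (u * (2 * m + 1) + i) / denFactor (ev q) 2 2 (u * (2 * m + 1) + i)) := by
    refine hz.mul (HasValue.sum fun v hv => ((hasValue_one_sub _).mul (hasValue_q.pow _)).mul
      (HasValue.prod fun i hi => (hasValue_numFactor _).div h (hasValue_denFactor _) ?_))
    rw [denFactor_two_periodic h.primitive.pow_eq_one]
    rw [mem_range] at hi hv
    exact h.ev_denFactor_ne (by omega)
  have hperiodic : ∀ v, (1 - ev q ^ (6 * (u * (2 * m + 1) + v) + 1)) *
      ev q ^ (2 * (u * (2 * m + 1) + v)) = (1 - ev q ^ (6 * v + 1)) * ev q ^ (2 * v) := fun v => by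
    rw [mul_add 6, mul_add 2, add_assoc, pow_periodic h.primitive.pow_eq_one,
      pow_periodic h.primitive.pow_eq_one]
  simp only [hperiodic, numFactor_two_periodic h.primitive.pow_eq_one,
    denFactor_two_periodic h.primitive.pow_eq_one] at key
  rw [h.sum_block_at_root hm hw, mul_zero] at key
  convert key using 1
  rw [mul_sum]
  refine sum_congr rfl fun v _ => ?_
  rw [prod_range_add]
  ring

theorem hasValue_sum_zero (h : IsLocalModel ι ev q (2 * m + 1)) (hm : 0 < m) {w : ℕ}
    (hw : w = 0 ∨ w = m + 1) (u : ℕ) :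
    HasValue ι ev (∑ k ∈ range (u * (2 * m + 1) + w), (1 - ι q ^ (6 * k + 1)) * ι q ^ (2 * k) *
      ∏ i ∈ range k, numFactor (ι q) 2 2 i / denFactor (ι q) 2 2 i) 0 := by
  have hfull : HasValue ι ev (∑ k ∈ range (u * (2 * m + 1)), (1 - ι q ^ (6 * k + 1)) *
      ι q ^ (2 * k) * ∏ i ∈ range k, numFactor (ι q) 2 2 i / denFactor (ι q) 2 2 i) 0 := by
    induction u with
    | zero => simpa using HasValue.zero
    | succ u ih =>
      rw [add_mul, one_mul, sum_range_add]
      simpa using ih.add (h.hasValue_block hm (Or.inr rfl) u)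
  rcases hw with rfl | rfl
  · simpa using hfull
  · rw [sum_range_add]
    simpa using hfull.add (h.hasValue_block hm (Or.inl rfl) u)

end Odd

end IsLocalModel

end Local

/-- The alternating Lambert-type sum in the second-order term of the evaluation. -/
def lambertSum {K : Type*} [Field K] (q : K) (m : ℕ) : K :=
  ∑ j ∈ Icc 1 m, (-1) ^ j * q ^ (2 * j) / (1 - q ^ (2 * j)) ^ 2

/-- The closed form of the quadratic sum modulo the fifth power of `1 - q ^ (4 * r + 1)`. -/
def quadraticValue {K : Type*} [Field K] (q : K) (r : ℕ) : K :=
  (1 - q ^ (4 * r + 1)) * (∏ j ∈ range r, (1 - q ^ (4 * j + 2)) / (1 - q ^ (4 * (j + 1)))) ^ 2 *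
    (1 - (1 - q ^ (4 * r + 1)) ^ 2 * (2 - q ^ (4 * r + 1)) * lambertSum q (2 * r))

/-- The truncated quadratic sum. -/
def quadraticSum {K : Type*} [Field K] (q : K) (M : ℕ) : K :=
  ∑ k ∈ range (M + 1), (1 - q ^ (6 * k + 1)) * q ^ (2 * k) *
    ∏ i ∈ range k, numFactor q 2 2 i / denFactor q 2 2 i

theorem lambertSum_two_mul {K : Type*} [Field K] (q : K) (r : ℕ) :
    lambertSum q (2 * r) = ∑ j ∈ range r, q ^ (4 * j + 4) / (1 - q ^ (4 * j + 4)) ^ 2 -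
      ∑ j ∈ range r, q ^ (4 * j + 2) / (1 - q ^ (4 * j + 2)) ^ 2 := by
  induction r with
  | zero => simp [lambertSum]
  | succ r ih =>
    rw [lambertSum] at ih ⊢
    rw [show 2 * (r + 1) = 2 * r + 1 + 1 by ring, sum_Icc_succ_top (by omega),
      sum_Icc_succ_top (by omega), ih, sum_range_succ, sum_range_succ,
      show 2 * (2 * r + 1) = 4 * r + 2 by ring, show 2 * (2 * r + 1 + 1) = 4 * r + 4 by ring,
      show (-1 : K) ^ (2 * r + 1 + 1) = 1 from Even.neg_one_pow ⟨r + 1, by ring⟩,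
      show (-1 : K) ^ (2 * r + 1) = -1 from Odd.neg_one_pow ⟨r, rfl⟩]
    ring

theorem Subring.exists_prod_one_sub {K α : Type*} [CommRing K] (R : Subring K) {δ : K} (hδ : δ ∈ R)
    {s : Finset α} {x : α → K} (hx : ∀ i ∈ s, x i ∈ R) :
    ∃ y ∈ R, ∏ i ∈ s, (1 - δ * x i) = 1 - δ * ∑ i ∈ s, x i + δ ^ 2 * y := by
  classical
  induction s using Finset.induction_on with
  | empty => exact ⟨0, R.zero_mem, by simp⟩
  | insert a s ha ih =>
    obtain ⟨y, hy, hprod⟩ := ih fun i hi => hx i (mem_insert_of_mem hi)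
    have hxa := hx a (mem_insert_self a s)
    have hsum : ∑ i ∈ s, x i ∈ R := R.sum_mem fun i hi => hx i (mem_insert_of_mem hi)
    refine ⟨y + x a * ∑ i ∈ s, x i - δ * x a * y, R.sub_mem (R.add_mem hy (R.mul_mem hxa hsum))
      (R.mul_mem (R.mul_mem hδ hxa) hy), ?_⟩
    rw [prod_insert ha, sum_insert ha, hprod]
    ring

theorem Subring.exists_second_order_expansion {K : Type*} [Field K] (R : Subring K)
    {t δ a b a₁ a₂ b₁ b₂ D N d n Z S G C₁ C₂ C₃ : K} (hδ : δ * t = (1 - t) ^ 2)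
    (hd : d = 1 - δ * b₁ + δ ^ 2 * b₂) (hn : n = 1 - δ * a₁ + δ ^ 2 * a₂)
    (ht0 : t ≠ 0) (hD0 : D ≠ 0) (hZ0 : Z ≠ 0) (hd0 : d ≠ 0)
    (h₀ : Z * S - C₁ - C₂ + C₃ = (1 - t) ^ 5 * G)
    (h₁ : C₁ * D = (1 - t) * N * (Z * (1 - δ * a)))
    (h₂ : C₂ * D = (1 - t) * N * (Z * (1 - δ * b)))
    (h₃ : C₃ * (D * d) = (1 - t) * (N * n) * (Z * (1 - δ * a) * (1 - δ * b)))
    (ht : t⁻¹ ∈ R) (hδR : δ ∈ R) (ha : a ∈ R) (hb : b ∈ R) (ha₁ : a₁ ∈ R) (ha₂ : a₂ ∈ R)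
    (hb₁ : b₁ ∈ R) (hb₂ : b₂ ∈ R) (hdR : d⁻¹ ∈ R) (hZR : Z⁻¹ ∈ R) (hND : N / D ∈ R)
    (hG : G ∈ R) :
    ∃ g ∈ R, S - (1 - t) * (N / D) * (1 - (1 - t) ^ 2 * (2 - t) * (b₁ - a₁)) =
      (1 - t) ^ 5 * g := by
  obtain ⟨w, hw⟩ : ∃ w, w = b₁ - a₁ := ⟨_, rfl⟩
  obtain ⟨y, hy⟩ : ∃ y, y = (a₂ - b₂ + b₁ * w - δ * b₂ * w) * d⁻¹ := ⟨_, rfl⟩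
  have hwR : w ∈ R := hw ▸ R.sub_mem hb₁ ha₁
  have hyR : y ∈ R := by
    rw [hy]
    exact R.mul_mem (R.sub_mem (R.add_mem (R.sub_mem ha₂ hb₂) (R.mul_mem hb₁ hwR))
      (R.mul_mem (R.mul_mem hδR hb₂) hwR)) hdR
  have hnd : n = (1 + δ * w + δ ^ 2 * y) * d := by
    have : y * d = a₂ - b₂ + b₁ * w - δ * b₂ * w := by rw [hy, inv_mul_cancel_right₀ hd0]
    linear_combination hn - (1 + δ * w) * hd - δ ^ 2 * this - δ * hw
  have hα : ∀ {x}, x ∈ R → 1 - δ * x ∈ R := fun hx => R.sub_mem R.one_mem (R.mul_mem hδR hx)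
  obtain ⟨s, hs⟩ : ∃ s, s = t⁻¹ := ⟨_, rfl⟩
  have hst : s * t = 1 := by rw [hs, inv_mul_cancel₀ ht0]
  have hδs : δ = (1 - t) ^ 2 * s := by linear_combination s * hδ - δ * hst
  obtain ⟨x, hx⟩ : ∃ x, x = -(a * b) + (a + b - δ * (a * b)) * w -
    (1 - δ * a) * (1 - δ * b) * y := ⟨_, rfl⟩
  have hxR : x ∈ R := by
    rw [hx]
    exact R.sub_mem (R.add_mem (R.neg_mem (R.mul_mem ha hb)) (R.mul_mem (R.sub_mem (R.add_mem ha hb)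
      (R.mul_mem hδR (R.mul_mem ha hb))) hwR)) (R.mul_mem (R.mul_mem (hα ha) (hα hb)) hyR)
  refine ⟨G * Z⁻¹ + N / D * (s ^ 2 * x - s * w), R.add_mem (R.mul_mem hG hZR) (R.mul_mem hND
    (R.sub_mem (R.mul_mem (R.pow_mem (hs ▸ ht) 2) hxR) (R.mul_mem (hs ▸ ht) hwR))), ?_⟩
  have e₁ : C₁ = (1 - t) * (N / D) * (Z * (1 - δ * a)) := by field_simp; linear_combination h₁
  have e₂ : C₂ = (1 - t) * (N / D) * (Z * (1 - δ * b)) := by field_simp; linear_combination h₂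
  have e₃ : C₃ = (1 - t) * (N / D) * (1 + δ * w + δ ^ 2 * y) *
      (Z * (1 - δ * a) * (1 - δ * b)) := by
    field_simp
    apply mul_right_cancel₀ hd0
    linear_combination h₃ + (1 - t) * N * (Z * (1 - δ * a) * (1 - δ * b)) * hnd
  have hS : S = (1 - t) ^ 5 * (G * Z⁻¹) + (1 - t) * (N / D) * (1 - δ * w + δ ^ 2 * x) := by
    apply mul_left_cancel₀ hZ0
    have : Z * Z⁻¹ = 1 := mul_inv_cancel₀ hZ0
    linear_combination h₀ + e₁ + e₂ - e₃ - (1 - t) ^ 5 * G * this - Z * (1 - t) * (N / D) * δ ^ 2 * hx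
  have e₄ : δ - (1 - t) ^ 2 * (2 - t) = (1 - t) ^ 4 * s := by
    linear_combination hδs + (1 - t) ^ 2 * (2 - t) * hst
  have e₅ : δ ^ 2 = (1 - t) ^ 4 * s ^ 2 := by rw [hδs]; ring
  rw [hS, ← hw]
  linear_combination (1 - t) * (N / D) * (x * e₅ - w * e₄)

section Local

variable {O K : Type*} [CommRing O] [Field K] {ι : O →+* K} {ev : O →+* ℂ} {q : O}

theorem HasValue.mem_range {x : K} {z : ℂ} (h : HasValue ι ev x z) : x ∈ ι.range := by
  obtain ⟨f, rfl, _⟩ := h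
  exact ⟨f, rfl⟩

theorem HasValue.of_mem_range {x : K} (h : x ∈ ι.range) : ∃ z, HasValue ι ev x z := by
  obtain ⟨f, rfl⟩ := h
  exact ⟨_, HasValue.of f⟩

namespace IsLocalModel

variable {m r : ℕ}

theorem hasValue_quadraticValue (h : IsLocalModel ι ev q (2 * m + 1)) (hm : 0 < m)
    (hr : 2 * m + 1 ∣ 4 * r + 1) : HasValue ι ev (quadraticValue (ι q) r) 0 := by
  obtain ⟨z, hz⟩ := h.exists_hasValue_prod (by omega)
    (Nat.Coprime.pow_left 2 (Nat.coprime_two_left.mpr (by simp)))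
    (Nat.Coprime.pow_left 2 (Nat.coprime_two_left.mpr (by simp))) 2 r
  rw [show 2 ^ 2 = 4 by norm_num] at hz
  have he : HasValue ι ev (1 - ι q ^ (4 * r + 1)) 0 := by
    have := hasValue_one_sub (ι := ι) (ev := ev) (q := q) (4 * r + 1)
    rwa [(h.primitive.pow_eq_one_iff_dvd _).mpr hr, sub_self] at this
  obtain ⟨w, hw⟩ : ∃ w, HasValue ι ev (1 - (1 - ι q ^ (4 * r + 1)) ^ 2 * (2 - ι q ^ (4 * r + 1)) *
      lambertSum (ι q) (2 * r)) w := by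
    apply HasValue.of_mem_range
    have hq : ∀ j, ι q ^ j ∈ ι.range := fun j => ι.range.pow_mem ⟨q, rfl⟩ j
    refine ι.range.sub_mem ι.range.one_mem ?_
    have : (1 - ι q ^ (4 * r + 1)) ^ 2 * (2 - ι q ^ (4 * r + 1)) * lambertSum (ι q) (2 * r) =
        (2 - ι q ^ (4 * r + 1)) * ∑ j ∈ Icc 1 (2 * r), (-1) ^ j * ι q ^ (2 * j) *
          ((1 - ι q ^ (4 * r + 1)) / (1 - ι q ^ (2 * j))) ^ 2 := by
      rw [lambertSum, mul_sum, mul_sum]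
      exact sum_congr rfl fun j _ => by rw [div_pow]; ring
    rw [this]
    refine ι.range.mul_mem (ι.range.sub_mem (ofNat_mem _ 2) (hq _))
      (ι.range.sum_mem fun j hj => ι.range.mul_mem (ι.range.mul_mem
        (ι.range.pow_mem (ι.range.neg_mem ι.range.one_mem) _) (hq _)) (ι.range.pow_mem ?_ _))
    obtain ⟨z, hz⟩ := h.exists_hasValue_div hr (j := 2 * j) (by rw [mem_Icc] at hj; omega)
    exact hz.mem_range
  simpa [quadraticValue] using (he.mul (hz.pow 2)).mul hw

theorem hasValue_quadraticSum_sub (h : IsLocalModel ι ev q (2 * m + 1)) (hm : 0 < m)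
    (hr : 2 * m + 1 ∣ 4 * r + 1) {M : ℕ} (hM : M = 2 * r ∨ M = 4 * r) :
    HasValue ι ev (quadraticSum (ι q) M - quadraticValue (ι q) r) 0 := by
  have hsum : HasValue ι ev (quadraticSum (ι q) M) 0 := by
    obtain ⟨c, hc⟩ := hr
    obtain ⟨u, rfl⟩ : ∃ u, c = 2 * u + 1 := by
      rcases Nat.even_or_odd' c with ⟨u, rfl | rfl⟩
      · rw [mul_left_comm] at hc
        omega
      · exact ⟨u, rfl⟩
    rcases hM with rfl | rfl
    · have := h.hasValue_sum_zero hm (Or.inr rfl) u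
      rwa [show u * (2 * m + 1) + (m + 1) = 2 * r + 1 by nlinarith] at this
    · have := h.hasValue_sum_zero hm (Or.inl rfl) (2 * u + 1)
      rwa [show (2 * u + 1) * (2 * m + 1) + 0 = 4 * r + 1 by rw [hc]; ring] at this
  simpa using hsum.sub (h.hasValue_quadraticValue hm hr)

theorem dvd_clearedSum_mixed_difference (h : IsLocalModel ι ev q (2 * m + 1)) (hm : 0 < m)
    {δ : O} (hδ : (1 - q ^ (2 * m + 1)) ^ 2 ∣ δ) :
    (1 - q ^ (2 * m + 1)) ^ 5 ∣ clearedSum q 2 2 m - clearedSum q (2 + δ) 2 m -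
      clearedSum q 2 (2 + δ) m + clearedSum q (2 + δ) (2 + δ) m := by
  let f : ℕ → Polynomial O := fun k => clearedLeft (Polynomial.C q) Polynomial.X m k
  let g : ℕ → Polynomial O := fun k => clearedRight (Polynomial.C q) Polynomial.X m k
  have hf : ∀ x k, clearedLeft q x m k = (f k).eval x := fun x k => (eval_clearedLeft q x m k).symm
  have hg : ∀ x k, clearedRight q x m k = (g k).eval x := fun x k =>
    (eval_clearedRight q x m k).symm
  have hder : 1 - q ^ (2 * m + 1) ∣ ∑ k ∈ range (m + 1), clearedCoeff q m k *
      (f k).derivative.eval 2 * (g k).derivative.eval 2 := by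
    apply h.dvd
    rw [map_sum, ← sum_derivative_of_isPrimitiveRoot hm h.primitive 2 2]
    refine sum_congr rfl fun k _ => ?_
    have e2 : (2 : ℂ) = ev 2 := (map_ofNat ev 2).symm
    have el : clearedLeft (Polynomial.C (ev q)) Polynomial.X m k = (f k).map ev := by
      simpa using (map_clearedLeft (Polynomial.mapRingHom ev) (Polynomial.C q) Polynomial.X m k).symm
    have er : clearedRight (Polynomial.C (ev q)) Polynomial.X m k = (g k).map ev := by
      simpa using
        (map_clearedRight (Polynomial.mapRingHom ev) (Polynomial.C q) Polynomial.X m k).symm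
    rw [map_mul, map_mul, map_clearedCoeff, el, er, Polynomial.derivative_map,
      Polynomial.derivative_map, e2, Polynomial.eval_map_apply, Polynomial.eval_map_apply]
  choose κ hκ using fun k => (⟨_, ((f k).binomExpansion 2 δ).2⟩ :
    ∃ c, (f k).eval (2 + δ) = (f k).eval 2 + (f k).derivative.eval 2 * δ + c * δ ^ 2)
  choose μ hμ using fun k => (⟨_, ((g k).binomExpansion 2 δ).2⟩ :
    ∃ c, (g k).eval (2 + δ) = (g k).eval 2 + (g k).derivative.eval 2 * δ + c * δ ^ 2)
  have key : clearedSum q 2 2 m - clearedSum q (2 + δ) 2 m - clearedSum q 2 (2 + δ) m +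
      clearedSum q (2 + δ) (2 + δ) m = δ ^ 2 * (∑ k ∈ range (m + 1), clearedCoeff q m k *
      (f k).derivative.eval 2 * (g k).derivative.eval 2 + δ * ∑ k ∈ range (m + 1),
        clearedCoeff q m k * (κ k * (g k).derivative.eval 2 + μ k * (f k).derivative.eval 2 +
          κ k * μ k * δ)) := by
    simp only [clearedSum, hf, hg, hκ, hμ, mul_sum, ← sum_sub_distrib, ← sum_add_distrib]
    exact sum_congr rfl fun k _ => by ring
  rw [key, show 5 = 2 * 2 + 1 by norm_num, pow_succ, pow_mul]
  refine mul_dvd_mul (pow_dvd_pow_of_dvd hδ 2) (dvd_add hder (Dvd.dvd.mul_right ?_ _))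
  exact (dvd_pow_self _ two_ne_zero).trans hδ

theorem quadFactor_two_add {K : Type*} [Field K] (q δ : K) {a : ℕ} (ha : 1 - q ^ a ≠ 0) :
    quadFactor q (2 + δ) a = (1 - q ^ a) ^ 2 * (1 - δ * (q ^ a / (1 - q ^ a) ^ 2)) := by
  rw [quadFactor]
  field_simp
  ring

theorem quadraticSum_sub_eq (h : IsLocalModel ι ev q (4 * r + 1)) (hr : 0 < r) :
    ∃ g ∈ ι.range, quadraticSum (ι q) (2 * r) - quadraticValue (ι q) r =
      (1 - ι q ^ (4 * r + 1)) ^ 5 * g := by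
  have hn : 2 * (2 * r) + 1 = 4 * r + 1 := by ring
  have h' : IsLocalModel ι ev q (2 * (2 * r) + 1) := by rwa [hn]
  have hζ0 : ev q ≠ 0 := h.primitive.ne_zero (by omega)
  obtain ⟨v, hv⟩ := h.isUnit q hζ0
  set p : O := ↑v⁻¹ with hp
  have hpq : p * q = 1 := by rw [← hv, hp, Units.inv_mul]
  set Q := ι q with hQ
  set T := Q ^ (4 * r + 1) with hT
  have hq0 : Q ≠ 0 := right_ne_zero_of_mul_eq_one (a := ι p) (by rw [← map_mul, hpq, map_one])
  have hT0 : T ≠ 0 := pow_ne_zero _ hq0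
  have h1 : ∀ j, 0 < j → 1 - Q ^ j ≠ 0 := fun j hj => h.map_one_sub_ne hj
  set δ' : O := (1 - q ^ (4 * r + 1)) ^ 2 * p ^ (4 * r + 1) with hδ'
  set δ := ι δ' with hδd
  have hδ : δ * T = (1 - T) ^ 2 := by
    rw [hδd, hδ', hT, hQ, ← map_pow, ← map_mul, mul_assoc, ← mul_pow, hpq, one_pow, mul_one]
    simp
  have hU : (2 + δ) * Q ^ (4 * r + 1) = 1 + Q ^ (2 * (4 * r + 1)) := by
    rw [mul_comm 2 (4 * r + 1), pow_mul, ← hT]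
    linear_combination hδ
  obtain ⟨G, hG⟩ := h'.dvd_clearedSum_mixed_difference (δ := δ') (by omega)
    (by rw [hn]; exact Dvd.intro _ rfl)
  have hG' := congrArg ι hG
  rw [hn] at hG'
  simp only [map_add, map_sub, map_mul, map_pow, map_one, map_clearedSum, map_ofNat, ← hQ, ← hδd,
    ← hT] at hG'
  have hE : ∀ a, 0 < a → quadFactor Q 2 a ≠ 0 := fun a ha => by
    rw [quadFactor_two]; exact pow_ne_zero _ (h1 a ha)
  have hE' : ∀ j, quadFactor Q (2 + δ) (4 * j + 4) ≠ 0 := fun j =>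
    quadFactor_ne_zero hq0 h1 hU (by omega) (by omega)
  have k1 := clearedSum_of_left_special hq0 h1 hU 2
  have k2 := clearedSum_of_right_special hq0 h1 (by omega : r ≤ 2 * r)
    (fun j => hE (4 * j + 4) (by omega)) hU
  have k3 := clearedSum_of_right_special hq0 h1 (by omega : r ≤ 2 * r) hE' hU
  have hden : ∀ i, denFactor Q 2 2 i ≠ 0 := fun i =>
    mul_ne_zero (mul_ne_zero (hE _ (by omega)) (hE _ (by omega))) (h1 _ (by omega))
  have k0 := clearedSum_eq_mul_sum (m := 2 * r) fun i _ => hden i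
  rw [← quadraticSum] at k0
  let v : ℕ → K := fun a => Q ^ a / (1 - Q ^ a) ^ 2
  have hspl : ∀ a, 0 < a → quadFactor Q (2 + δ) a = quadFactor Q 2 a * (1 - δ * v a) :=
    fun a ha => by rw [quadFactor_two_add _ _ (h1 a ha), quadFactor_two]
  have d1 : ∏ i ∈ range (2 * r), denFactor Q (2 + δ) 2 i =
      (∏ i ∈ range (2 * r), denFactor Q 2 2 i) * ∏ i ∈ range (2 * r), (1 - δ * v (4 * i + 4)) := by
    rw [← prod_mul_distrib]
    exact prod_congr rfl fun i _ => by rw [denFactor, hspl _ (by omega), denFactor]; ring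
  have d2 : ∏ i ∈ range (2 * r), denFactor Q 2 (2 + δ) i =
      (∏ i ∈ range (2 * r), denFactor Q 2 2 i) * ∏ i ∈ range (2 * r), (1 - δ * v (2 * i + 2)) := by
    rw [← prod_mul_distrib]
    exact prod_congr rfl fun i _ => by rw [denFactor, hspl _ (by omega), denFactor]; ring
  have d3 : ∏ i ∈ range (2 * r), denFactor Q (2 + δ) (2 + δ) i =
      (∏ i ∈ range (2 * r), denFactor Q 2 2 i) * (∏ i ∈ range (2 * r), (1 - δ * v (4 * i + 4))) *
        ∏ i ∈ range (2 * r), (1 - δ * v (2 * i + 2)) := by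
    rw [← prod_mul_distrib, ← prod_mul_distrib]
    exact prod_congr rfl fun i _ => by
      rw [denFactor, hspl _ (by omega), hspl _ (by omega), denFactor]; ring
  have d4 : ∏ j ∈ range r, quadFactor Q (2 + δ) (4 * j + 4) =
      (∏ j ∈ range r, quadFactor Q 2 (4 * j + 4)) * ∏ j ∈ range r, (1 - δ * v (4 * j + 4)) := by
    rw [← prod_mul_distrib]
    exact prod_congr rfl fun i _ => hspl _ (by omega)
  have d5 : ∏ j ∈ range r, quadFactor Q (2 + δ) (4 * j + 2) =
      (∏ j ∈ range r, quadFactor Q 2 (4 * j + 2)) * ∏ j ∈ range r, (1 - δ * v (4 * j + 2)) := by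
    rw [← prod_mul_distrib]
    exact prod_congr rfl fun i _ => hspl _ (by omega)
  rw [d1] at k1
  rw [d2] at k2
  rw [d3, d4, d5] at k3
  have hdvd4 : ∀ i < 2 * r, ¬ 4 * r + 1 ∣ 4 * i + 4 := fun i hi ⟨c, hc⟩ => by
    rcases c with _ | _ | c
    · omega
    · omega
    · nlinarith
  have hdvd : ∀ a, 0 < a → a ≤ 4 * r → ¬ 4 * r + 1 ∣ a := fun a ha ha' hdv => by
    have := Nat.le_of_dvd ha hdv
    omega
  have hvR : ∀ {a}, ¬ 4 * r + 1 ∣ a → v a ∈ ι.range := fun ha =>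
    ((hasValue_q.pow _).div h ((hasValue_one_sub _).pow 2)
      (pow_ne_zero 2 (h.ev_one_sub_ne ha))).mem_range
  have hsumR : ∀ {k} {f : ℕ → ℕ}, (∀ i < k, ¬ 4 * r + 1 ∣ f i) →
      ∑ i ∈ range k, v (f i) ∈ ι.range := fun hf =>
    ι.range.sum_mem fun i hi => hvR (hf i (mem_range.mp hi))
  have hexp : ∀ {k} {f : ℕ → ℕ}, (∀ i < k, ¬ 4 * r + 1 ∣ f i) → ∃ y ∈ ι.range,
      ∏ i ∈ range k, (1 - δ * v (f i)) = 1 - δ * ∑ i ∈ range k, v (f i) + δ ^ 2 * y := fun hf =>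
    ι.range.exists_prod_one_sub ⟨δ', rfl⟩ fun i hi => hvR (hf i (mem_range.mp hi))
  have hlin : ∀ {k} {f : ℕ → ℕ}, (∀ i < k, ¬ 4 * r + 1 ∣ f i) → ∃ y ∈ ι.range,
      ∏ i ∈ range k, (1 - δ * v (f i)) = 1 - δ * y := fun {k f} hf => by
    obtain ⟨y, hy, he⟩ := hexp hf
    refine ⟨∑ i ∈ range k, v (f i) - δ * y, ι.range.sub_mem (hsumR hf)
      (ι.range.mul_mem ⟨δ', rfl⟩ hy), ?_⟩
    rw [he]
    ring
  obtain ⟨a, haR, ha⟩ := hlin hdvd4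
  obtain ⟨b, hbR, hb⟩ := hlin (k := 2 * r) (f := fun i => 2 * i + 2)
    fun i hi => hdvd _ (by omega) (by omega)
  have hf4 : ∀ j < r, ¬ 4 * r + 1 ∣ 4 * j + 4 := fun j hj => hdvd4 j (by omega)
  have hf2 : ∀ j < r, ¬ 4 * r + 1 ∣ 4 * j + 2 := fun j hj => hdvd _ (by omega) (by omega)
  obtain ⟨b₂, hb₂R, hb₂⟩ := hexp hf4
  obtain ⟨a₂, ha₂R, ha₂⟩ := hexp hf2
  have hND : (∏ j ∈ range r, quadFactor Q 2 (4 * j + 2)) / ∏ j ∈ range r, quadFactor Q 2 (4 * j + 4) =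
      (∏ j ∈ range r, (1 - Q ^ (4 * j + 2)) / (1 - Q ^ (4 * (j + 1)))) ^ 2 := by
    rw [← prod_div_distrib, ← prod_pow]
    exact prod_congr rfl fun j _ => by rw [quadFactor_two, quadFactor_two, div_pow, mul_add_one]
  have hδ0 : HasValue ι ev δ 0 := ⟨δ', rfl, by simp [hδ', h.primitive.pow_eq_one]⟩
  have hdval : HasValue ι ev (∏ j ∈ range r, (1 - δ * v (4 * j + 4))) 1 := by
    obtain ⟨z, hz⟩ := HasValue.of_mem_range (ev := ev) (hsumR hf4)
    obtain ⟨w, hw⟩ := HasValue.of_mem_range (ev := ev) hb₂R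
    rw [hb₂]
    simpa using (HasValue.one.sub (hδ0.mul hz)).add ((hδ0.pow 2).mul hw)
  rw [ha] at k1
  rw [hb] at k2
  rw [ha, hb] at k3
  rw [k0] at hG'
  rw [quadraticValue, lambertSum_two_mul, ← hND, ← hT]
  refine ι.range.exists_second_order_expansion hδ hb₂ ha₂ hT0
    (prod_ne_zero_iff.mpr fun j _ => hE _ (by omega)) (prod_ne_zero_iff.mpr fun i _ => hden i) ?_
    hG' k1 k2 k3 ?_ ⟨δ', rfl⟩ haR hbR (hsumR hf2) ha₂R (hsumR hf4) hb₂R ?_ ?_ ?_ ⟨G, rfl⟩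
  · exact prod_ne_zero_iff.mpr fun j _ h0 => hE' j (by rw [hspl _ (by omega), h0, mul_zero])
  · rw [← one_div]
    exact (HasValue.one.div h (hasValue_q.pow _) (pow_ne_zero _ hζ0)).mem_range
  · rw [← one_div]
    exact (HasValue.one.div h hdval one_ne_zero).mem_range
  · rw [← one_div]
    exact (HasValue.one.div h (HasValue.prod fun i _ => hasValue_denFactor i)
      (prod_ne_zero_iff.mpr fun i hi => h'.ev_denFactor_ne
        (by rw [mem_range] at hi; omega))).mem_range
  · rw [← prod_div_distrib]
    refine ι.range.prod_mem fun j hj => ?_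
    rw [quadFactor_two, quadFactor_two]
    exact (((hasValue_one_sub _).pow 2).div h ((hasValue_one_sub _).pow 2)
      (pow_ne_zero 2 (h.ev_one_sub_ne (hf4 j (mem_range.mp hj))))).mem_range

end IsLocalModel

end Local

section Local

variable {O K : Type*} [CommRing O] [Field K] {ι : O →+* K} {ev : O →+* ℂ} {q : O}

namespace IsLocalModel

variable {r : ℕ}

private theorem exists_tail_term_eq (h : IsLocalModel ι ev q (4 * r + 1)) (hr : 0 < r) {k : ℕ}
    (hk : 2 * r < k) (hk' : k ≤ 4 * r) : ∃ g ∈ ι.range, (1 - ι q ^ (6 * k + 1)) * ι q ^ (2 * k) *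
      ∏ i ∈ range k, numFactor (ι q) 2 2 i / denFactor (ι q) 2 2 i =
        (1 - ι q ^ (4 * r + 1)) ^ 5 * g := by
  have hn : 2 * (2 * r) + 1 = 4 * r + 1 := by ring
  have hnum : ∏ i ∈ range k, numFactor (ι q) 2 2 i = (1 - ι q ^ (4 * r + 1)) ^ 5 *
      ((1 - ι q ^ (8 * r + 1)) ^ 2 * (1 + ι q ^ (4 * r + 1)) * (1 - ι q ^ (2 * r + 1)) ^ 2 *
        (1 - ι q ^ (4 * r + 2)) * ∏ i ∈ ((range k).erase (2 * r)).erase r,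
          numFactor (ι q) 2 2 i) := by
    rw [← mul_prod_erase (range k) _ (mem_range.mpr hk), ← mul_prod_erase ((range k).erase (2 * r)) _
      (show r ∈ _ from mem_erase.mpr ⟨by omega, mem_range.mpr (by omega)⟩)]
    generalize ∏ i ∈ ((range k).erase (2 * r)).erase r, numFactor (ι q) 2 2 i = P
    rw [numFactor, numFactor, quadFactor_two, quadFactor_two, quadFactor_two, quadFactor_two, hn,
      show 4 * (2 * r) + 2 = (4 * r + 1) * 2 by ring, show 4 * (2 * r) = 8 * r by ring, pow_mul]
    generalize ι q ^ (4 * r + 1) = t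
    generalize ι q ^ (8 * r + 1) = u
    generalize ι q ^ (2 * r + 1) = v
    generalize ι q ^ (4 * r + 2) = w
    ring
  refine ⟨(1 - ι q ^ (6 * k + 1)) * ι q ^ (2 * k) * (((1 - ι q ^ (8 * r + 1)) ^ 2 *
    (1 + ι q ^ (4 * r + 1)) * (1 - ι q ^ (2 * r + 1)) ^ 2 * (1 - ι q ^ (4 * r + 2)) *
    ∏ i ∈ ((range k).erase (2 * r)).erase r, numFactor (ι q) 2 2 i) /
      ∏ i ∈ range k, denFactor (ι q) 2 2 i), HasValue.mem_range (ev := ev)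
    (((hasValue_one_sub _).mul (hasValue_q.pow _)).mul ((((((hasValue_one_sub _).pow 2).mul
      (HasValue.one.add (hasValue_q.pow _))).mul ((hasValue_one_sub _).pow 2)).mul
      (hasValue_one_sub _)).mul (HasValue.prod fun i _ => hasValue_numFactor i) |>.div h
      (HasValue.prod fun i _ => hasValue_denFactor i) (prod_ne_zero_iff.mpr fun i hi => ?_))), ?_⟩
  · rw [← hn] at h
    exact h.ev_denFactor_ne (by rw [mem_range] at hi; omega)
  · rw [prod_div_distrib, hnum]
    ring

/-- The quadratic sum agrees with its closed form to the fifth order at `q ^ (4 * r + 1) = 1`. -/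
theorem exists_quadraticSum_sub_eq (h : IsLocalModel ι ev q (4 * r + 1)) (hr : 0 < r) {M : ℕ}
    (hM : M = 2 * r ∨ M = 4 * r) : ∃ g ∈ ι.range,
      quadraticSum (ι q) M - quadraticValue (ι q) r = (1 - ι q ^ (4 * r + 1)) ^ 5 * g := by
  obtain ⟨g, hg, he⟩ := h.quadraticSum_sub_eq hr
  rcases hM with rfl | rfl
  · exact ⟨g, hg, he⟩
  choose! f hf hfe using fun i (hi : i < 2 * r) =>
    h.exists_tail_term_eq hr (k := 2 * r + 1 + i) (by omega) (by omega)
  refine ⟨g + ∑ i ∈ range (2 * r), f i, ι.range.add_mem hg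
    (ι.range.sum_mem fun i hi => hf i (mem_range.mp hi)), ?_⟩
  have hsplit : quadraticSum (ι q) (4 * r) = quadraticSum (ι q) (2 * r) +
      (1 - ι q ^ (4 * r + 1)) ^ 5 * ∑ i ∈ range (2 * r), f i := by
    rw [quadraticSum, show 4 * r + 1 = 2 * r + 1 + 2 * r by ring, sum_range_add, ← quadraticSum,
      mul_sum, show 2 * r + 1 + 2 * r = 4 * r + 1 by ring]
    exact congrArg _ (sum_congr rfl fun i hi => hfe i (mem_range.mp hi))
  rw [hsplit]
  linear_combination he

end IsLocalModel

end Local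

namespace Polynomial

theorem exists_X_pow_sub_one_eq_cyclotomic_mul {d : ℕ} (hd : 0 < d) {ζ : ℂ}
    (hζ : IsPrimitiveRoot ζ d) :
    ∃ g : ℚ[X], X ^ d - 1 = cyclotomic d ℚ * g ∧ aeval ζ g ≠ 0 := by
  obtain ⟨g, hg⟩ := cyclotomic.dvd_X_pow_sub_one d ℚ
  refine ⟨g, hg, fun h0 => ?_⟩
  have hc : aeval ζ (cyclotomic d ℚ) = 0 := by
    rw [cyclotomic_eq_minpoly_rat hζ hd, minpoly.aeval]
  have := congrArg (fun p => aeval ζ (derivative p)) hg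
  simp only [derivative_mul, map_add, map_mul, h0, hc, derivative_X_pow,
    derivative_one, map_sub, map_pow, aeval_X, mul_zero, zero_mul, add_zero, sub_zero,
    map_natCast, mul_eq_zero, pow_eq_zero_iff', Nat.cast_eq_zero] at this
  rcases this with h | h
  · omega
  · exact hζ.ne_zero hd.ne' h.1

theorem cyclotomic_dvd_iff_aeval_eq_zero {d : ℕ} (hd : 0 < d) {ζ : ℂ} (hζ : IsPrimitiveRoot ζ d)
    {a : ℚ[X]} : cyclotomic d ℚ ∣ a ↔ aeval ζ a = 0 := by
  rw [cyclotomic_eq_minpoly_rat hζ hd, minpoly.dvd_iff]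

end Polynomial

open Polynomial in
/-- The localization of `ℚ[X]` at the cyclotomic polynomial `Φ_d`, realised inside `ℚ(X)`. -/
theorem exists_isLocalModel_ratFunc {d : ℕ} (hd : 0 < d) :
    ∃ (O : Type) (_ : CommRing O) (ι : O →+* RatFunc ℚ) (ev : O →+* ℂ) (q : O),
      IsLocalModel ι ev q d ∧ ι q = RatFunc.X ∧ ∀ x : RatFunc ℚ, ∀ j : ℕ,
        (∃ g ∈ ι.range, x = (1 - RatFunc.X ^ d) ^ j * g) → cyclotomic d ℚ ^ j ∣ x.num := by
  obtain ⟨ζ, hζ⟩ : ∃ ζ : ℂ, IsPrimitiveRoot ζ d := ⟨_, Complex.isPrimitiveRoot_exp d hd.ne'⟩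
  let e : ℚ[X] →+* ℂ := (aeval ζ : ℚ[X] →ₐ[ℚ] ℂ).toRingHom
  have he : ∀ a, e a = aeval ζ a := fun _ => rfl
  let S : Submonoid ℚ[X] := (nonZeroDivisors ℂ).comap e
  have hS : ∀ {a}, a ∈ S ↔ e a ≠ 0 := by
    intro a
    rw [Submonoid.mem_comap, mem_nonZeroDivisors_iff_ne_zero]
  have hS0 : ∀ {a}, a ∈ S → a ≠ 0 := fun ha h0 => hS.mp ha (by rw [h0, map_zero])
  have hι : ∀ s : S, IsUnit (algebraMap ℚ[X] (RatFunc ℚ) s) := fun s =>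
    isUnit_iff_ne_zero.mpr ((map_ne_zero_iff _ (RatFunc.algebraMap_injective ℚ)).mpr (hS0 s.2))
  have hev : ∀ s : S, IsUnit (e s) := fun s => isUnit_iff_ne_zero.mpr (hS.mp s.2)
  let ι : Localization S →+* RatFunc ℚ := IsLocalization.lift hι
  let ev : Localization S →+* ℂ := IsLocalization.lift hev
  have hmk : ∀ f : Localization S, ∃ a, ∃ s : S, f * algebraMap ℚ[X] _ (s : ℚ[X]) =
      algebraMap ℚ[X] (Localization S) a := fun f => by
    obtain ⟨⟨a, s⟩, h⟩ := IsLocalization.surj S f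
    exact ⟨a, s, h⟩
  have hιa : ∀ a, ι (algebraMap ℚ[X] _ a) = algebraMap ℚ[X] (RatFunc ℚ) a :=
    IsLocalization.lift_eq hι
  have heva : ∀ a, ev (algebraMap ℚ[X] _ a) = e a := IsLocalization.lift_eq hev
  have hunit : ∀ {a}, a ∈ S → IsUnit (algebraMap ℚ[X] (Localization S) a) := fun ha =>
    IsLocalization.map_units _ (⟨_, ha⟩ : S)
  have hinj : Function.Injective ι := by
    refine (injective_iff_map_eq_zero ι).mpr fun f hf => ?_
    obtain ⟨a, s, h⟩ := hmk f
    have h0 := congrArg ι h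
    rw [map_mul, hf, zero_mul, hιa, eq_comm, map_eq_zero_iff _ (RatFunc.algebraMap_injective ℚ)]
      at h0
    rw [h0, map_zero] at h
    exact (hunit s.2).mul_left_eq_zero.mp h
  obtain ⟨g, hg, hgζ⟩ := exists_X_pow_sub_one_eq_cyclotomic_mul hd hζ
  refine ⟨Localization S, inferInstance, ι, ev, algebraMap ℚ[X] _ X,
    ⟨hinj, fun f hf => ?_, fun f hf => ?_, ?_, fun j hj h0 => ?_⟩, ?_, ?_⟩
  · obtain ⟨a, s, h⟩ := hmk f
    refine isUnit_of_mul_isUnit_left (y := algebraMap ℚ[X] _ (s : ℚ[X])) (h ▸ hunit (hS.mpr ?_))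
    rw [← heva, ← h, map_mul, heva]
    exact mul_ne_zero hf (hS.mp s.2)
  · obtain ⟨a, s, h⟩ := hmk f
    have h0 := congrArg ev h
    rw [map_mul, hf, zero_mul, heva, eq_comm] at h0
    obtain ⟨b, rfl⟩ := (cyclotomic_dvd_iff_aeval_eq_zero hd hζ).mpr h0
    rw [← (hunit s.2).dvd_mul_right, h, ← map_pow, ← map_one (algebraMap ℚ[X] (Localization S)),
      ← map_sub, ← neg_dvd, ← map_neg, neg_sub, hg, map_mul, map_mul,
      (hunit (hS.mpr hgζ)).mul_right_dvd]
    exact dvd_mul_right _ _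
  · rw [heva, he, aeval_X]
    exact hζ
  · have h1 := congrArg ι h0
    rw [← map_pow, ← map_one (algebraMap ℚ[X] (Localization S)), ← map_sub, hιa, map_zero,
      map_eq_zero_iff _ (RatFunc.algebraMap_injective ℚ)] at h1
    have h2 := congrArg (eval 0) h1
    simp [hj.ne'] at h2
  · rw [hιa, RatFunc.algebraMap_X]
  · rintro x j ⟨_, ⟨f, rfl⟩, hx⟩
    obtain ⟨a, s, h⟩ := hmk f
    have h0 := congrArg ι h
    rw [map_mul, hιa, hιa] at h0
    have hx' : x.num * (s : ℚ[X]) = (1 - X ^ d) ^ j * a * x.denom := by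
      apply RatFunc.algebraMap_injective ℚ
      have hden : algebraMap ℚ[X] (RatFunc ℚ) x.denom ≠ 0 :=
        (map_ne_zero_iff _ (RatFunc.algebraMap_injective ℚ)).mpr x.denom_ne_zero
      have hnum := x.num_div_denom
      rw [div_eq_iff hden] at hnum
      simp only [map_mul, map_pow, map_sub, map_one, RatFunc.algebraMap_X]
      rw [hnum, ← h0]
      nth_rewrite 1 [hx]
      ring
    have hcop : IsCoprime (cyclotomic d ℚ ^ j) (s : ℚ[X]) :=
      (((cyclotomic.irreducible_rat hd).coprime_iff_not_dvd).mpr fun hdv =>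
        hS.mp s.2 ((cyclotomic_dvd_iff_aeval_eq_zero hd hζ).mp hdv)).pow_left
    refine hcop.dvd_of_dvd_mul_right ?_
    rw [hx', mul_assoc]
    refine Dvd.dvd.mul_right (pow_dvd_pow_of_dvd ?_ j) _
    rw [← dvd_neg, neg_sub]
    exact cyclotomic.dvd_X_pow_sub_one d ℚ

end QuadraticSum

section Translation

open Finset

variable {K : Type*} [Field K] {q : K}

theorem qPoch_pow_pow (q : K) (a b k : ℕ) :
    qPoch (q ^ a) (q ^ b) k = ∏ i ∈ range k, (1 - q ^ (b * i + a)) := by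
  rw [qPoch]
  exact prod_congr rfl fun i _ => by rw [← pow_mul, ← pow_add, add_comm]

theorem qint_eq_div (hq : 1 - q ≠ 0) (r : ℕ) : qint q r = (1 - q ^ r) / (1 - q) := by
  rw [qint, eq_div_iff hq, mul_comm, mul_neg_geom_sum]

theorem sum_qPoch_eq_quadraticSum_div (hq : 1 - q ≠ 0) (M : ℕ) :
    ∑ k ∈ range (M + 1), qint q (6 * k + 1) * qPoch q (q ^ 2) k ^ 2 * qPoch (q ^ 2) (q ^ 4) k *
      qPoch q (q ^ 4) k ^ 2 / (qPoch (q ^ 2) (q ^ 2) k ^ 2 * qPoch (q ^ 4) (q ^ 4) k ^ 3) *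
      q ^ (2 * k) = quadraticSum q M / (1 - q) := by
  rw [quadraticSum, sum_div]
  refine sum_congr rfl fun k _ => ?_
  have hnum : ∏ i ∈ range k, numFactor q 2 2 i =
      qPoch q (q ^ 2) k ^ 2 * qPoch q (q ^ 4) k ^ 2 * qPoch (q ^ 2) (q ^ 4) k := by
    have h2 := qPoch_pow_pow q 1 2 k
    have h4 := qPoch_pow_pow q 1 4 k
    rw [pow_one] at h2 h4
    rw [h2, h4, qPoch_pow_pow, ← prod_pow, ← prod_pow, ← prod_mul_distrib, ← prod_mul_distrib]
    exact prod_congr rfl fun i _ => by rw [numFactor, quadFactor_two, quadFactor_two]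
  have hden : ∏ i ∈ range k, denFactor q 2 2 i =
      qPoch (q ^ 2) (q ^ 2) k ^ 2 * qPoch (q ^ 4) (q ^ 4) k ^ 3 := by
    rw [qPoch_pow_pow, qPoch_pow_pow, ← prod_pow, ← prod_pow, ← prod_mul_distrib]
    exact prod_congr rfl fun i _ => by rw [denFactor, quadFactor_two, quadFactor_two]; ring
  rw [prod_div_distrib, hnum, hden, qint_eq_div hq]
  ring

theorem qint_mul_qPoch_eq_quadraticValue_div (hq : 1 - q ≠ 0) (r : ℕ) :
    qint q (4 * r + 1) * (qPoch (q ^ 2) (q ^ 4) r ^ 2 / qPoch (q ^ 4) (q ^ 4) r ^ 2) *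
      (1 + qint q (4 * r + 1) ^ 2 * (2 - q ^ (4 * r + 1)) * ∑ j ∈ Icc 1 (2 * r),
        (-1) ^ (j + 1) * q ^ (2 * j) / qint q (2 * j) ^ 2) = quadraticValue q r / (1 - q) := by
  have hsum : ∑ j ∈ Icc 1 (2 * r), (-1) ^ (j + 1) * q ^ (2 * j) / qint q (2 * j) ^ 2 =
      -(1 - q) ^ 2 * lambertSum q (2 * r) := by
    rw [lambertSum, mul_sum]
    exact sum_congr rfl fun j _ => by rw [qint_eq_div hq, div_pow, div_div_eq_mul_div]; ring
  have hprod : ∏ j ∈ range r, (1 - q ^ (4 * j + 2)) / (1 - q ^ (4 * (j + 1))) =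
      qPoch (q ^ 2) (q ^ 4) r / qPoch (q ^ 4) (q ^ 4) r := by
    rw [qPoch_pow_pow, qPoch_pow_pow, ← prod_div_distrib]
    exact prod_congr rfl fun j _ => by rw [mul_add_one]
  rw [hsum, quadraticValue, hprod, qint_eq_div hq]
  field_simp
  ring

end Translation

section Global

open Finset Polynomial

variable {r M : ℕ}

theorem cyclotomic_pow_five_dvd_num (hr : 0 < r) (hM : M = 2 * r ∨ M = 4 * r) :
    cyclotomic (4 * r + 1) ℚ ^ 5 ∣ ((quadraticSum (RatFunc.X : RatFunc ℚ) M -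
      quadraticValue RatFunc.X r) / (1 - RatFunc.X)).num := by
  obtain ⟨O, _, ι, ev, q, h, hq, hdvd⟩ := exists_isLocalModel_ratFunc (d := 4 * r + 1) (by omega)
  obtain ⟨g, hg, he⟩ := h.exists_quadraticSum_sub_eq hr hM
  rw [hq] at he
  obtain ⟨z, hz⟩ := HasValue.of_mem_range (ev := ev) hg
  have hz' := hz.div h (IsLocalModel.hasValue_one_sub 1)
    (h.ev_one_sub_ne (Nat.not_dvd_of_pos_of_lt one_pos (by omega)))
  rw [hq, pow_one] at hz'
  exact hdvd _ _ ⟨_, hz'.mem_range, by rw [he, mul_div_assoc]⟩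

theorem cyclotomic_dvd_num {d : ℕ} (hd : 1 < d) (hdr : d ∣ 4 * r + 1)
    (hM : M = 2 * r ∨ M = 4 * r) :
    cyclotomic d ℚ ∣ ((quadraticSum (RatFunc.X : RatFunc ℚ) M -
      quadraticValue RatFunc.X r) / (1 - RatFunc.X)).num := by
  obtain ⟨m, rfl⟩ : Odd d := Odd.of_dvd_nat ⟨2 * r, by ring⟩ hdr
  obtain ⟨O, _, ι, ev, q, h, hq, hdvd⟩ := exists_isLocalModel_ratFunc (d := 2 * m + 1) (by omega)
  have hz := (h.hasValue_quadraticSum_sub (by omega) hdr hM).div h (IsLocalModel.hasValue_one_sub 1)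
    (h.ev_one_sub_ne (Nat.not_dvd_of_pos_of_lt one_pos (by omega)))
  rw [hq, pow_one, zero_div] at hz
  obtain ⟨f, hf, hf0⟩ := hz
  obtain ⟨g, rfl⟩ := h.dvd f hf0
  rw [← pow_one (cyclotomic _ _)]
  exact hdvd _ _ ⟨ι g, ⟨g, rfl⟩, by rw [← hf, pow_one, map_mul, map_sub, map_one, map_pow, hq]⟩

theorem geom_sum_mul_cyclotomic_pow_four_dvd_num (hM : M = 2 * r ∨ M = 4 * r) :
    (∑ i ∈ range (4 * r + 1), (X : ℚ[X]) ^ i) * cyclotomic (4 * r + 1) ℚ ^ 4 ∣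
      ((quadraticSum (RatFunc.X : RatFunc ℚ) M - quadraticValue RatFunc.X r) /
        (1 - RatFunc.X)).num := by
  rcases Nat.eq_zero_or_pos r with rfl | hr
  · obtain rfl : M = 0 := by omega
    simp [quadraticSum, quadraticValue, lambertSum]
  rw [← prod_cyclotomic_eq_geom_sum (by omega), ← mul_prod_erase (((4 * r + 1).divisors).erase 1) _
    (show 4 * r + 1 ∈ _ by simp; omega), mul_right_comm, ← pow_succ']
  have hcop : ∀ a b, a ≠ b → IsCoprime (cyclotomic a ℚ) (cyclotomic b ℚ) := fun a b hab =>
    cyclotomic.isCoprime_rat hab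
  refine IsCoprime.mul_dvd (IsCoprime.prod_right fun d hd =>
    (hcop _ _ (ne_of_mem_erase hd).symm).pow_left) (cyclotomic_pow_five_dvd_num hr hM)
    (prod_dvd_of_coprime (fun a _ b _ hab => hcop a b hab) fun d hd => ?_)
  have hd' := mem_of_mem_erase hd
  rw [mem_erase, Nat.mem_divisors] at hd'
  have := Nat.pos_of_dvd_of_pos hd'.2.1 (by omega)
  exact cyclotomic_dvd_num (by omega) hd'.2.1 hM

end Global

theorem stmt_9 (n : ℕ) (hn : 0 < n) (h4 : n % 4 = 1) (M : ℕ)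
    (hM : M = (n - 1) / 2 ∨ M = n - 1) :
    ((∑ i ∈ Finset.range n, (Polynomial.X : Polynomial ℚ) ^ i) *
        Polynomial.cyclotomic n ℚ ^ 4) ∣
      ((∑ k ∈ Finset.range (M + 1),
          qint (RatFunc.X : RatFunc ℚ) (6 * k + 1) *
            qPoch RatFunc.X (RatFunc.X ^ 2) k ^ 2 *
            qPoch ((RatFunc.X : RatFunc ℚ) ^ 2) (RatFunc.X ^ 4) k *
            qPoch RatFunc.X (RatFunc.X ^ 4) k ^ 2 /
            (qPoch ((RatFunc.X : RatFunc ℚ) ^ 2) (RatFunc.X ^ 2) k ^ 2 *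
              qPoch ((RatFunc.X : RatFunc ℚ) ^ 4) (RatFunc.X ^ 4) k ^ 3) *
            RatFunc.X ^ (2 * k)) -
        qint (RatFunc.X : RatFunc ℚ) n *
          (qPoch ((RatFunc.X : RatFunc ℚ) ^ 2) (RatFunc.X ^ 4) ((n - 1) / 4) ^ 2 /
            qPoch ((RatFunc.X : RatFunc ℚ) ^ 4) (RatFunc.X ^ 4) ((n - 1) / 4) ^ 2) *
          (1 + qint (RatFunc.X : RatFunc ℚ) n ^ 2 *
              (2 - (RatFunc.X : RatFunc ℚ) ^ n) *
              ∑ j ∈ Finset.Icc 1 ((n - 1) / 2),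
                (-1 : RatFunc ℚ) ^ (j + 1) * (RatFunc.X : RatFunc ℚ) ^ (2 * j) /
                  qint (RatFunc.X : RatFunc ℚ) (2 * j) ^ 2)).num := by
  obtain ⟨r, rfl⟩ : ∃ r, n = 4 * r + 1 := ⟨n / 4, by omega⟩
  have hX : (1 : RatFunc ℚ) - RatFunc.X ≠ 0 := by
    rw [← RatFunc.algebraMap_X, ← map_one (algebraMap (Polynomial ℚ) (RatFunc ℚ)), ← map_sub]
    refine (map_ne_zero_iff _ (RatFunc.algebraMap_injective ℚ)).mpr fun h => ?_
    simpa using congrArg (Polynomial.eval 0) h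
  rw [show (4 * r + 1 - 1) / 4 = r by omega, show (4 * r + 1 - 1) / 2 = 2 * r by omega,
    sum_qPoch_eq_quadraticSum_div hX, qint_mul_qPoch_eq_quadraticValue_div hX, ← sub_div]
  exact geom_sum_mul_cyclotomic_pow_four_dvd_num (by omega)
end

section
/- Let n > 1 be an odd positive integer, let M = (n-1)/2 or M = n-1, and let a, b be indeterminates. Then the sum Σ_{k=0}^{M} [6k+1]·(q,aq,q/a;q²)_k·(q/b;q⁴)_k / ((q⁴,q⁴/a,aq⁴;q⁴)_k·(bq²;q²)_k) · q^{k²+k}·b^k, viewed as a rational function of q over ℚ(a,b), is congruent to 0 modulo [n]. -/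
/-- The field ℚ(a,b) of rational functions in two indeterminates over ℚ. -/
abbrev Qab : Type := FractionRing (MvPolynomial (Fin 2) ℚ)

/-- The indeterminate `a` in ℚ(a,b), viewed inside the rational function field in `q`. -/
noncomputable def aa : RatFunc Qab :=
  RatFunc.C (algebraMap (MvPolynomial (Fin 2) ℚ) Qab (MvPolynomial.X 0))

/-- The indeterminate `b` in ℚ(a,b), viewed inside the rational function field in `q`. -/
noncomputable def bb : RatFunc Qab :=
  RatFunc.C (algebraMap (MvPolynomial (Fin 2) ℚ) Qab (MvPolynomial.X 1))

open Finset

/-- The summand of the series without its factor `[6k+1]`. -/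
def qTerm {K : Type*} [Field K] (q a b : K) (k : ℕ) : K :=
  (qPoch q (q ^ 2) k * qPoch (a * q) (q ^ 2) k * qPoch (q / a) (q ^ 2) k) *
      qPoch (q / b) (q ^ 4) k /
    ((qPoch (q ^ 4) (q ^ 4) k * qPoch (q ^ 4 / a) (q ^ 4) k * qPoch (a * q ^ 4) (q ^ 4) k) *
      qPoch (b * q ^ 2) (q ^ 2) k) * q ^ (k ^ 2 + k) * b ^ k

section Field

variable {K : Type*} [Field K]

@[simp]
lemma qPoch_zero (x q : K) : qPoch x q 0 = 1 := by simp [qPoch]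

lemma qPoch_succ (x q : K) (k : ℕ) : qPoch x q (k + 1) = qPoch x q k * (1 - x * q ^ k) := by
  simp [qPoch, prod_range_succ]

@[simp]
lemma qTerm_zero (q a b : K) : qTerm q a b 0 = 1 := by simp [qTerm]

lemma qTerm_succ (q a b : K) (k : ℕ) :
    qTerm q a b (k + 1) = qTerm q a b k *
      ((1 - q * (q ^ 2) ^ k) * (1 - a * q * (q ^ 2) ^ k) * (1 - q / a * (q ^ 2) ^ k) *
          (1 - q / b * (q ^ 4) ^ k) /
        ((1 - q ^ 4 * (q ^ 4) ^ k) * (1 - q ^ 4 / a * (q ^ 4) ^ k) *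
          (1 - a * q ^ 4 * (q ^ 4) ^ k) * (1 - b * q ^ 2 * (q ^ 2) ^ k)) *
        (q ^ 2 * (q ^ 2) ^ k * b)) := by
  have h : q ^ ((k + 1) ^ 2 + (k + 1)) = q ^ (k ^ 2 + k) * (q ^ 2 * (q ^ 2) ^ k) := by
    rw [← pow_mul, ← pow_add, ← pow_add]
    congr 1
    ring
  simp only [qTerm, qPoch_succ, h, pow_succ b]
  simp only [div_eq_mul_inv, mul_inv]
  ring

/-- The recurrence of `qTerm` with denominators cleared, in terms of `x = q ^ (2k)`. -/
lemma qTerm_succ_mul {q a b : K} (ha : a ≠ 0) (hb : b ≠ 0) (k : ℕ)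
    (h1 : 1 - q ^ 4 * ((q ^ 2) ^ k) ^ 2 ≠ 0) (h2 : a - q ^ 4 * ((q ^ 2) ^ k) ^ 2 ≠ 0)
    (h3 : 1 - a * q ^ 4 * ((q ^ 2) ^ k) ^ 2 ≠ 0) (h4 : 1 - b * q ^ 2 * (q ^ 2) ^ k ≠ 0) :
    qTerm q a b (k + 1) * ((1 - q ^ 4 * ((q ^ 2) ^ k) ^ 2) * (a - q ^ 4 * ((q ^ 2) ^ k) ^ 2) *
        (1 - a * q ^ 4 * ((q ^ 2) ^ k) ^ 2) * (1 - b * q ^ 2 * (q ^ 2) ^ k)) =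
      qTerm q a b k * ((1 - q * (q ^ 2) ^ k) * (1 - a * q * (q ^ 2) ^ k) *
        (a - q * (q ^ 2) ^ k) * (b - q * ((q ^ 2) ^ k) ^ 2) * (q ^ 2 * (q ^ 2) ^ k)) := by
  rw [qTerm_succ]
  have e : (q ^ 4) ^ k = ((q ^ 2) ^ k) ^ 2 := by ring
  rw [e]
  generalize (q ^ 2) ^ k = x at *
  have h2' : 1 - q ^ 4 / a * x ^ 2 ≠ 0 := by
    intro h
    apply h2
    have : a - q ^ 4 * x ^ 2 = a * (1 - q ^ 4 / a * x ^ 2) := by field_simp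
    rw [this, h, mul_zero]
  have e1 : a - q ^ 4 * x ^ 2 = a * (1 - q ^ 4 / a * x ^ 2) := by field_simp
  have e2 : a - q * x = a * (1 - q / a * x) := by field_simp
  have e3 : b - q * x ^ 2 = b * (1 - q / b * x ^ 2) := by field_simp
  rw [e1, e2, e3]
  generalize 1 - q ^ 4 / a * x ^ 2 = d2 at *
  generalize 1 - q / a * x = n2 at *
  generalize 1 - q / b * x ^ 2 = n3 at *
  generalize 1 - a * q ^ 4 * x ^ 2 = d3 at *
  generalize 1 - b * q ^ 2 * x = d4 at *
  generalize 1 - q ^ 4 * x ^ 2 = d1 at *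
  field_simp

/-- Nonvanishing of every denominator that occurs when `q` is a root of unity. -/
structure Generic (q a b : K) : Prop where
  a_ne_zero : a ≠ 0
  b_ne_zero : b ≠ 0
  a_sub : ∀ j : ℕ, a - q ^ j ≠ 0
  one_sub_a : ∀ j : ℕ, 1 - a * q ^ j ≠ 0
  b_sub : ∀ j : ℕ, b - q ^ j ≠ 0
  one_sub_b : ∀ j : ℕ, 1 - b * q ^ j ≠ 0

lemma IsPrimitiveRoot.one_sub_pow_ne_zero {q : K} {m j : ℕ} (hq : IsPrimitiveRoot q m)
    (h : ¬ m ∣ j) : 1 - q ^ j ≠ 0 := fun h0 =>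
  h ((hq.pow_eq_one_iff_dvd j).1 (sub_eq_zero.1 h0).symm)

lemma not_dvd_four_mul {m k : ℕ} (hm : Odd m) (h : ¬ m ∣ k) : ¬ m ∣ 4 * k := fun h4 =>
  h ((Nat.Coprime.pow_right 2 (Nat.coprime_two_right.2 hm) :
    Nat.Coprime m (2 ^ 2)).dvd_of_dvd_mul_left h4)

lemma Generic.qTerm_succ_mul {q a b : K} (hg : Generic q a b) {m : ℕ} (hq : IsPrimitiveRoot q m)
    (hm : Odd m) {k : ℕ} (hk : ¬ m ∣ k + 1) :
    qTerm q a b (k + 1) * ((1 - q ^ 4 * ((q ^ 2) ^ k) ^ 2) * (a - q ^ 4 * ((q ^ 2) ^ k) ^ 2) *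
        (1 - a * q ^ 4 * ((q ^ 2) ^ k) ^ 2) * (1 - b * q ^ 2 * (q ^ 2) ^ k)) =
      qTerm q a b k * ((1 - q * (q ^ 2) ^ k) * (1 - a * q * (q ^ 2) ^ k) *
        (a - q * (q ^ 2) ^ k) * (b - q * ((q ^ 2) ^ k) ^ 2) * (q ^ 2 * (q ^ 2) ^ k)) := by
  have e : q ^ 4 * ((q ^ 2) ^ k) ^ 2 = q ^ (4 * (k + 1)) := by ring
  apply _root_.qTerm_succ_mul hg.a_ne_zero hg.b_ne_zero
  · rw [e]; exact hq.one_sub_pow_ne_zero (not_dvd_four_mul hm hk)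
  · rw [e]; exact hg.a_sub _
  · rw [mul_assoc, e]; exact hg.one_sub_a _
  · rw [mul_assoc, ← pow_mul, ← pow_add]; exact hg.one_sub_b _

lemma Generic.shift {q a b : K} (hg : Generic q a b) {m : ℕ} (hq : IsPrimitiveRoot q m)
    (hm : m ≠ 0) : Generic q a (b * q ^ 4) where
  a_ne_zero := hg.a_ne_zero
  b_ne_zero := mul_ne_zero hg.b_ne_zero (pow_ne_zero _ (hq.ne_zero hm))
  a_sub := hg.a_sub
  one_sub_a := hg.one_sub_a
  b_sub j h := by
    have e : q ^ (4 * m) = 1 := by rw [mul_comm, pow_mul, hq.pow_eq_one, one_pow]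
    obtain ⟨i, hi⟩ : ∃ i, 4 * m = 4 + i := ⟨4 * m - 4, by omega⟩
    refine hg.b_sub (j + i) ?_
    rw [hi, pow_add] at e
    rw [pow_add]
    linear_combination q ^ i * h - b * e
  one_sub_b j := by
    rw [mul_assoc, ← pow_add]
    exact hg.one_sub_b _

/-- The effect of `b ↦ b q⁴` on a summand. -/
lemma Generic.qTerm_shift {q a b : K} (hg : Generic q a b) {m : ℕ} (hq : IsPrimitiveRoot q m)
    (hm : Odd m) {k : ℕ} (hk : k < m) :
    qTerm q a (b * q ^ 4) k * ((b * q ^ 3 - ((q ^ 2) ^ k) ^ 2) * (1 - b * q ^ 2 * (q ^ 2) ^ k) *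
        (1 - b * q ^ 4 * (q ^ 2) ^ k)) =
      qTerm q a b k * (((q ^ 2) ^ k) ^ 2 * (b * q ^ 3 - 1) * (1 - b * q ^ 2) *
        (1 - b * q ^ 4)) := by
  induction k with
  | zero => simp
  | succ k ih =>
    specialize ih (by omega)
    have hd : ¬ m ∣ k + 1 := Nat.not_dvd_of_pos_of_lt (by omega) hk
    have h1 := hg.qTerm_succ_mul hq hm hd
    have h2 := (hg.shift hq hm.pos.ne').qTerm_succ_mul hq hm hd
    have e : q ^ 4 * ((q ^ 2) ^ k) ^ 2 = q ^ (4 * (k + 1)) := by ring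
    have n1 : 1 - q ^ 4 * ((q ^ 2) ^ k) ^ 2 ≠ 0 := by
      rw [e]; exact hq.one_sub_pow_ne_zero (not_dvd_four_mul hm hd)
    have n2 : a - q ^ 4 * ((q ^ 2) ^ k) ^ 2 ≠ 0 := by rw [e]; exact hg.a_sub _
    have n3 : 1 - a * q ^ 4 * ((q ^ 2) ^ k) ^ 2 ≠ 0 := by
      rw [mul_assoc, e]; exact hg.one_sub_a _
    have n4 : 1 - b * q ^ 2 * (q ^ 2) ^ k ≠ 0 := by
      rw [mul_assoc, ← pow_mul, ← pow_add]; exact hg.one_sub_b _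
    have ex : (q ^ 2) ^ (k + 1) = q ^ 2 * (q ^ 2) ^ k := by ring
    rw [ex]
    generalize (q ^ 2) ^ k = x at *
    generalize qTerm q a b (k + 1) = u' at *
    generalize qTerm q a (b * q ^ 4) (k + 1) = v' at *
    generalize qTerm q a b k = u at *
    generalize qTerm q a (b * q ^ 4) k = v at *
    refine mul_right_cancel₀ (mul_ne_zero (mul_ne_zero (mul_ne_zero n1 n2) n3) n4) ?_
    linear_combination
      (b * q ^ 3 - x ^ 2 * q ^ 4) * (1 - b * q ^ 4 * x) * (1 - b * q ^ 2 * x) * h2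
      + (1 - q * x) * (1 - a * q * x) * (a - q * x) * q ^ 3 * x * (b * q ^ 3 - x ^ 2 * q ^ 4) * ih
      - x ^ 2 * q ^ 4 * (b * q ^ 3 - 1) * (1 - b * q ^ 2) * (1 - b * q ^ 4) * h1

/-- Creative telescoping in `b ↦ b q⁴`. -/
lemma Generic.sum_telescope {q a b : K} (hg : Generic q a b) {m : ℕ} (hq : IsPrimitiveRoot q m)
    (hm : Odd m) {k : ℕ} (hk : k < m) :
    (∑ i ∈ range k, (1 - q * ((q ^ 2) ^ i) ^ 3) *
        ((a - q ^ 3 * b) * (1 - a * q ^ 3 * b) * qTerm q a (b * q ^ 4) i -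
          a * (1 - b * q ^ 2) * (1 - b * q ^ 4) * qTerm q a b i)) *
        ((b * q ^ 3 - ((q ^ 2) ^ k) ^ 2) * (1 - b * q ^ 2 * (q ^ 2) ^ k)) =
      qTerm q a b k * ((1 - b * q ^ 2) * (1 - b * q ^ 4) * (1 - ((q ^ 2) ^ k) ^ 2) *
        (a - ((q ^ 2) ^ k) ^ 2) * (1 - a * ((q ^ 2) ^ k) ^ 2) * (q ^ 3 * b)) := by
  induction k with
  | zero => simp
  | succ k ih =>
    specialize ih (by omega)
    have hd : ¬ m ∣ k + 1 := Nat.not_dvd_of_pos_of_lt (by omega) hk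
    have h1 := hg.qTerm_succ_mul hq hm hd
    have h2 := hg.qTerm_shift hq hm (k := k) (by omega)
    have n1 : b * q ^ 3 - ((q ^ 2) ^ k) ^ 2 ≠ 0 := fun h => by
      have e : q ^ (3 * m) = 1 := by rw [mul_comm, pow_mul, hq.pow_eq_one, one_pow]
      obtain ⟨i, hi⟩ : ∃ i, 3 * m = 3 + i := ⟨3 * m - 3, by omega⟩
      refine hg.b_sub (2 * k * 2 + i) ?_
      rw [hi, pow_add] at e
      rw [pow_add, pow_mul, pow_mul]
      linear_combination q ^ i * h - b * e
    have n2 : 1 - b * q ^ 2 * (q ^ 2) ^ k ≠ 0 := by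
      rw [mul_assoc, ← pow_mul, ← pow_add]; exact hg.one_sub_b _
    have ex : (q ^ 2) ^ (k + 1) = q ^ 2 * (q ^ 2) ^ k := by ring
    rw [sum_range_succ, ex]
    generalize ∑ i ∈ range k, (1 - q * ((q ^ 2) ^ i) ^ 3) *
        ((a - q ^ 3 * b) * (1 - a * q ^ 3 * b) * qTerm q a (b * q ^ 4) i -
          a * (1 - b * q ^ 2) * (1 - b * q ^ 4) * qTerm q a b i) = S at *
    generalize (q ^ 2) ^ k = x at *
    generalize qTerm q a b (k + 1) = u' at *
    generalize qTerm q a b k = u at *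
    generalize qTerm q a (b * q ^ 4) k = v at *
    refine mul_right_cancel₀ (mul_ne_zero n1 n2) ?_
    linear_combination (b * q ^ 3 - x ^ 2 * q ^ 4) * (1 - b * q ^ 4 * x) * ih
      + (1 - q * x ^ 3) * (a - q ^ 3 * b) * (1 - a * q ^ 3 * b) * (b * q ^ 3 - x ^ 2 * q ^ 4) * h2
      - (1 - b * q ^ 2) * (1 - b * q ^ 4) * q ^ 3 * b * (b * q ^ 3 - x ^ 2) * h1

lemma qTerm_eq_zero {q : K} (a b : K) {N k : ℕ} (hq : q ^ (2 * N + 1) = 1) (hk : N < k) :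
    qTerm q a b k = 0 := by
  have : qPoch q (q ^ 2) k = 0 :=
    prod_eq_zero (mem_range.2 hk) (by rw [← pow_mul, ← pow_succ', hq, sub_self])
  simp [qTerm, this]

lemma IsPrimitiveRoot.prod_range_sub_mul_pow {q : K} {m : ℕ} (hq : IsPrimitiveRoot q m)
    (hm : 0 < m) (x y : K) : ∏ j ∈ range m, (x - y * q ^ j) = x ^ m - y ^ m := by
  rw [hq.pow_sub_pow_eq_prod_sub_mul x y hm]
  refine prod_bij (fun j _ => q ^ j) ?_ ?_ ?_ ?_
  · intro j _
    rw [Polynomial.mem_nthRootsFinset hm, ← pow_mul, mul_comm, pow_mul, hq.pow_eq_one, one_pow]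
  · intro i hi j hj h
    exact hq.pow_inj (mem_range.1 hi) (mem_range.1 hj) h
  · intro z hz
    have : NeZero m := ⟨hm.ne'⟩
    obtain ⟨i, hi, h⟩ := hq.eq_pow_of_pow_eq_one ((Polynomial.mem_nthRootsFinset hm _).1 hz)
    exact ⟨i, mem_range.2 hi, h⟩
  · intro j _
    rw [mul_comm]

lemma Generic.sum_shift {q a b : K} (hg : Generic q a b) {N : ℕ}
    (hq : IsPrimitiveRoot q (2 * N + 1)) (hN : 0 < N) :
    (a - q ^ 3 * b) * (1 - a * q ^ 3 * b) *
        ∑ i ∈ range (N + 1), (1 - q * ((q ^ 2) ^ i) ^ 3) * qTerm q a (b * q ^ 4) i =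
      a * (1 - b * q ^ 2) * (1 - b * q ^ 4) *
        ∑ i ∈ range (N + 1), (1 - q * ((q ^ 2) ^ i) ^ 3) * qTerm q a b i := by
  have h := hg.sum_telescope hq ⟨N, rfl⟩ (k := N + 1) (by omega)
  rw [qTerm_eq_zero a b hq.pow_eq_one N.lt_succ_self, zero_mul] at h
  have n1 : b * q ^ 3 - ((q ^ 2) ^ (N + 1)) ^ 2 ≠ 0 := fun h => by
    have hq1 := hq.pow_eq_one
    refine hg.b_sub (2 * N) ?_
    have hq0 : q ^ 3 ≠ 0 := pow_ne_zero _ (hq.ne_zero (by omega))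
    refine mul_right_cancel₀ hq0 ?_
    linear_combination h + q ^ (2 * N + 3) * hq1
  have n2 : 1 - b * q ^ 2 * (q ^ 2) ^ (N + 1) ≠ 0 := by
    rw [mul_assoc, ← pow_mul, ← pow_add]; exact hg.one_sub_b _
  have h0 := (mul_eq_zero.1 h).resolve_right (mul_ne_zero n1 n2)
  rw [← sub_eq_zero, ← h0, mul_sum, mul_sum, ← sum_sub_distrib]
  refine sum_congr rfl fun i _ => ?_
  ring

/-- The truncated series vanishes at primitive roots of unity of odd order. -/
lemma Generic.sum_eq_zero {q a b : K} (hg : Generic q a b) {N : ℕ}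
    (hq : IsPrimitiveRoot q (2 * N + 1)) (hN : 0 < N) (ha : a ^ (2 * N + 1) ≠ 1) :
    ∑ i ∈ range (N + 1), (1 - q * ((q ^ 2) ^ i) ^ 3) * qTerm q a b i = 0 := by
  set S : K → K := fun b => ∑ i ∈ range (N + 1), (1 - q * ((q ^ 2) ^ i) ^ 3) * qTerm q a b i
    with hS
  have iter : ∀ J : ℕ, Generic q a (b * (q ^ 4) ^ J) ∧
      (∏ j ∈ range J, (a - q ^ 3 * b * (q ^ 4) ^ j)) *
        (∏ j ∈ range J, (1 - a * q ^ 3 * b * (q ^ 4) ^ j)) * S (b * (q ^ 4) ^ J) =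
      a ^ J * (∏ j ∈ range J, (1 - b * q ^ 2 * (q ^ 4) ^ j)) *
        (∏ j ∈ range J, (1 - b * q ^ 4 * (q ^ 4) ^ j)) * S b := by
    intro J
    induction J with
    | zero => simpa using hg
    | succ J ih =>
      obtain ⟨hJ, e⟩ := ih
      have h := hJ.sum_shift hq hN
      rw [mul_assoc b, ← pow_succ] at h
      refine ⟨?_, ?_⟩
      · rw [pow_succ, ← mul_assoc]
        exact hJ.shift hq (by omega)
      · simp only [prod_range_succ]
        change _ * _ * S (b * (q ^ 4) ^ (J + 1)) = _ * _ * _ * S (b * (q ^ 4) ^ J) at h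
        linear_combination (∏ j ∈ range J, (a - q ^ 3 * b * (q ^ 4) ^ j)) *
          (∏ j ∈ range J, (1 - a * q ^ 3 * b * (q ^ 4) ^ j)) * h +
          a * (1 - b * (q ^ 4) ^ J * q ^ 2) * (1 - b * (q ^ 4) ^ J * q ^ 4) * e
  have h4 : IsPrimitiveRoot (q ^ 4) (2 * N + 1) :=
    hq.pow_of_coprime 4 (Nat.Coprime.pow_left 2 (by simp) : Nat.Coprime (2 ^ 2) (2 * N + 1))
  have h := (iter (2 * N + 1)).2
  have hq1 := hq.pow_eq_one
  have e : ∀ r : ℕ, (q ^ r) ^ (2 * N + 1) = 1 := fun r => by rw [pow_right_comm, hq1, one_pow]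
  simp only [h4.prod_range_sub_mul_pow (Nat.succ_pos _), mul_pow, e, one_pow,
    mul_one, one_mul] at h
  have h' : b ^ (2 * N + 1) * (a ^ (2 * N + 1) - 1) ^ 2 * S b = 0 := by linear_combination -h
  exact (mul_eq_zero.1 h').resolve_left
    (mul_ne_zero (pow_ne_zero _ hg.b_ne_zero) (pow_ne_zero _ (sub_ne_zero.2 ha)))

lemma qint_mul (q : K) (r : ℕ) : qint q r * (1 - q) = 1 - q ^ r := by
  rw [qint, geom_sum_mul_neg]

lemma Generic.sum_qint_eq_zero {q a b : K} (hg : Generic q a b) {N : ℕ}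
    (hq : IsPrimitiveRoot q (2 * N + 1)) (hN : 0 < N) (ha : a ^ (2 * N + 1) ≠ 1)
    {M : ℕ} (hM : N < M) :
    ∑ i ∈ range M, qint q (6 * i + 1) * qTerm q a b i = 0 := by
  have h1 : 1 - q ≠ 0 := sub_ne_zero.2 (hq.ne_one (by omega)).symm
  refine mul_right_cancel₀ h1 ?_
  rw [zero_mul, ← hg.sum_eq_zero hq hN ha, sum_mul,
    ← sum_subset (range_subset_range.2 (Nat.succ_le_of_lt hM))]
  · refine sum_congr rfl fun i _ => ?_
    rw [mul_right_comm, qint_mul]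
    ring
  · intro i _ hi
    rw [qTerm_eq_zero a b hq.pow_eq_one (by simpa using hi), mul_zero, zero_mul]

end Field

section HasVal

variable {K L : Type*} [Field K] [Field L]

/-- The rational function `f` has no pole at `z` and takes the value `v` there. -/
def HasVal (φ : K →+* L) (z : L) (f : RatFunc K) (v : L) : Prop :=
  ∃ P D : Polynomial K, D.eval₂ φ z ≠ 0 ∧
    f * algebraMap (Polynomial K) (RatFunc K) D = algebraMap (Polynomial K) (RatFunc K) P ∧
    P.eval₂ φ z = v * D.eval₂ φ z

namespace HasVal

variable {φ : K →+* L} {z : L} {f g : RatFunc K} {v w : L}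

lemma congr (hf : HasVal φ z f v) (h : g = f) : HasVal φ z g v := h ▸ hf

lemma const (φ : K →+* L) (z : L) (c : K) : HasVal φ z (RatFunc.C c) (φ c) :=
  ⟨Polynomial.C c, 1, by simp, by simp, by simp⟩

lemma one (φ : K →+* L) (z : L) : HasVal φ z 1 1 := ⟨1, 1, by simp, by simp, by simp⟩

lemma zero (φ : K →+* L) (z : L) : HasVal φ z 0 0 := ⟨0, 1, by simp, by simp, by simp⟩

lemma var (φ : K →+* L) (z : L) : HasVal φ z RatFunc.X z :=
  ⟨Polynomial.X, 1, by simp, by simp, by simp⟩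

lemma add (hf : HasVal φ z f v) (hg : HasVal φ z g w) : HasVal φ z (f + g) (v + w) := by
  obtain ⟨P, D, h1, h2, h3⟩ := hf
  obtain ⟨Q, E, k1, k2, k3⟩ := hg
  refine ⟨P * E + Q * D, D * E, ?_, ?_, ?_⟩
  · rw [Polynomial.eval₂_mul]; exact mul_ne_zero h1 k1
  · simp only [map_mul, map_add, ← h2, ← k2]; ring
  · simp only [Polynomial.eval₂_mul, Polynomial.eval₂_add, h3, k3]; ring

lemma mul (hf : HasVal φ z f v) (hg : HasVal φ z g w) : HasVal φ z (f * g) (v * w) := by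
  obtain ⟨P, D, h1, h2, h3⟩ := hf
  obtain ⟨Q, E, k1, k2, k3⟩ := hg
  refine ⟨P * Q, D * E, ?_, ?_, ?_⟩
  · rw [Polynomial.eval₂_mul]; exact mul_ne_zero h1 k1
  · simp only [map_mul, ← h2, ← k2]; ring
  · simp only [Polynomial.eval₂_mul, h3, k3]; ring

lemma neg (hf : HasVal φ z f v) : HasVal φ z (-f) (-v) := by
  obtain ⟨P, D, h1, h2, h3⟩ := hf
  exact ⟨-P, D, h1, by rw [map_neg, ← h2, neg_mul], by rw [Polynomial.eval₂_neg, h3, neg_mul]⟩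

lemma sub (hf : HasVal φ z f v) (hg : HasVal φ z g w) : HasVal φ z (f - g) (v - w) := by
  simpa only [sub_eq_add_neg] using hf.add hg.neg

lemma inv (hf : HasVal φ z f v) (hv : v ≠ 0) : HasVal φ z f⁻¹ v⁻¹ := by
  obtain ⟨P, D, h1, h2, h3⟩ := hf
  have hP : P.eval₂ φ z ≠ 0 := h3 ▸ mul_ne_zero hv h1
  refine ⟨D, P, hP, ?_, ?_⟩
  · have hf0 : f ≠ 0 := by
      rintro rfl
      rw [zero_mul, eq_comm, map_eq_zero_iff _ (RatFunc.algebraMap_injective K)] at h2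
      exact hP (by rw [h2, Polynomial.eval₂_zero])
    rw [← h2, inv_mul_cancel_left₀ hf0]
  · rw [h3, inv_mul_cancel_left₀ hv]

lemma div (hf : HasVal φ z f v) (hg : HasVal φ z g w) (hw : w ≠ 0) :
    HasVal φ z (f / g) (v / w) := by
  simpa only [div_eq_mul_inv] using hf.mul (hg.inv hw)

lemma pow (hf : HasVal φ z f v) (k : ℕ) : HasVal φ z (f ^ k) (v ^ k) := by
  induction k with
  | zero => simpa using one φ z
  | succ k ih => simpa only [pow_succ] using ih.mul hf

lemma sum {F : ℕ → RatFunc K} {V : ℕ → L} (h : ∀ i, HasVal φ z (F i) (V i)) (k : ℕ) :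
    HasVal φ z (∑ i ∈ range k, F i) (∑ i ∈ range k, V i) := by
  induction k with
  | zero => simpa using zero φ z
  | succ k ih => simpa only [sum_range_succ] using ih.add (h k)

lemma qint (hf : HasVal φ z f v) (k : ℕ) : HasVal φ z (qint f k) (qint v k) :=
  sum (fun i => hf.pow i) k

lemma qPoch (hf : HasVal φ z f v) (hg : HasVal φ z g w) (k : ℕ) :
    HasVal φ z (qPoch f g k) (qPoch v w k) := by
  induction k with
  | zero => simpa using one φ z
  | succ k ih =>
    simpa only [qPoch_succ] using ih.mul ((one φ z).sub (hf.mul (hg.pow k)))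

lemma eval₂_num_eq_zero (hf : HasVal φ z f 0) : f.num.eval₂ φ z = 0 := by
  obtain ⟨P, D, h1, h2, h3⟩ := hf
  have h : f.num * D = P * f.denom := by
    apply RatFunc.algebraMap_injective K
    have hd : algebraMap (Polynomial K) (RatFunc K) f.denom ≠ 0 :=
      RatFunc.algebraMap_ne_zero f.denom_ne_zero
    rw [map_mul, map_mul, ← h2]
    nth_rewrite 2 [← RatFunc.num_div_denom f]
    field_simp
  have h' := congrArg (Polynomial.eval₂ φ z) h
  rw [Polynomial.eval₂_mul, Polynomial.eval₂_mul, h3, zero_mul, zero_mul] at h'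
  exact (mul_eq_zero.1 h').resolve_right h1

end HasVal

lemma RatFunc.one_sub_X_pow_ne_zero (k : ℕ) :
    1 - (RatFunc.X : RatFunc K) * RatFunc.X ^ k ≠ 0 := by
  rw [← pow_succ', sub_ne_zero, ← RatFunc.algebraMap_X, ← map_pow,
    ← map_one (algebraMap (Polynomial K) (RatFunc K))]
  intro h
  have h' := congrArg Polynomial.natDegree (RatFunc.algebraMap_injective K h)
  simp at h'

lemma qPoch_X_ne_zero (k : ℕ) : qPoch (RatFunc.X : RatFunc K) RatFunc.X k ≠ 0 :=
  prod_ne_zero_iff.2 fun i _ => RatFunc.one_sub_X_pow_ne_zero i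

/-- Gaussian binomial coefficients have no poles. -/
lemma exists_hasVal_gaussian (φ : K →+* L) (z : L) (k l : ℕ) :
    ∃ v, HasVal φ z (qPoch RatFunc.X RatFunc.X (k + l) /
      (qPoch RatFunc.X RatFunc.X k * qPoch RatFunc.X RatFunc.X l)) v := by
  induction k generalizing l with
  | zero => exact ⟨1, by simpa [qPoch_X_ne_zero] using HasVal.one φ z⟩
  | succ k ihk =>
    induction l with
    | zero => exact ⟨1, by simpa [qPoch_X_ne_zero] using HasVal.one φ z⟩
    | succ l ihl =>
      obtain ⟨v, hv⟩ := ihk (l + 1)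
      obtain ⟨w, hw⟩ := ihl
      refine ⟨_, (hv.add (((HasVal.var φ z).pow (k + 1)).mul hw)).congr ?_⟩
      have h1 := qPoch_X_ne_zero (K := K) k
      have h2 := qPoch_X_ne_zero (K := K) l
      have h3 := RatFunc.one_sub_X_pow_ne_zero (K := K) k
      have h4 := RatFunc.one_sub_X_pow_ne_zero (K := K) l
      rw [show k + 1 + (l + 1) = (k + l + 1) + 1 by ring, show k + (l + 1) = k + l + 1 by ring,
        show k + 1 + l = k + l + 1 by ring, qPoch_succ _ _ k, qPoch_succ _ _ l,
        qPoch_succ _ _ (k + l + 1)]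
      field_simp
      ring

lemma qPoch_mul_qPoch_neg (x q : K) (k : ℕ) :
    qPoch x q k * qPoch (-x) q k = qPoch (x ^ 2) (q ^ 2) k := by
  rw [qPoch, qPoch, qPoch, ← prod_mul_distrib]
  exact prod_congr rfl fun i _ => by ring

lemma qPoch_two_mul (q : K) (k : ℕ) :
    qPoch q q (2 * k) = qPoch q (q ^ 2) k * qPoch (q ^ 2) (q ^ 2) k := by
  induction k with
  | zero => simp
  | succ k ih =>
    rw [show 2 * (k + 1) = 2 * k + 1 + 1 by ring]
    simp only [qPoch_succ, ih]
    ring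

lemma exists_hasVal_qPoch_div (φ : K →+* L) {z : L} (hz : ∀ j : ℕ, 1 + z ^ j ≠ 0) (k : ℕ) :
    ∃ v, HasVal φ z (qPoch RatFunc.X (RatFunc.X ^ 2) k /
      qPoch (RatFunc.X ^ 4) (RatFunc.X ^ 4) k) v := by
  obtain ⟨v, hv⟩ := exists_hasVal_gaussian φ z k k
  have hX := HasVal.var φ z
  have h1 := hX.neg.qPoch hX k
  have h2 := (hX.pow 2).neg.qPoch (hX.pow 2) k
  have n1 : qPoch (-z) z k ≠ 0 := prod_ne_zero_iff.2 fun i _ => by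
    rw [neg_mul, sub_neg_eq_add, ← pow_succ']; exact hz _
  have n2 : qPoch (-z ^ 2) (z ^ 2) k ≠ 0 := prod_ne_zero_iff.2 fun i _ => by
    rw [neg_mul, sub_neg_eq_add, ← pow_succ', ← pow_mul]; exact hz _
  refine ⟨_, (hv.div ((h1.pow 2).mul h2) (mul_ne_zero (pow_ne_zero 2 n1) n2)).congr ?_⟩
  have e1 := qPoch_mul_qPoch_neg (RatFunc.X : RatFunc K) RatFunc.X k
  have e2 := qPoch_mul_qPoch_neg ((RatFunc.X : RatFunc K) ^ 2) (RatFunc.X ^ 2) k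
  rw [← two_mul, qPoch_two_mul, ← e1]
  rw [← e1] at e2
  rw [show (4 : ℕ) = 2 * 2 from rfl, pow_mul, ← e2]
  have h0 := qPoch_X_ne_zero (K := K) k
  by_cases m1 : qPoch (-RatFunc.X : RatFunc K) RatFunc.X k = 0
  · simp [m1]
  · field_simp


variable {φ : K →+* L} {z : L}

lemma Generic.exists_hasVal {a b : K} (hg : Generic z (φ a) (φ b)) (hz : ∀ j : ℕ, 1 + z ^ j ≠ 0)
    (k : ℕ) : ∃ v, HasVal φ z (qTerm RatFunc.X (RatFunc.C a) (RatFunc.C b) k) v := by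
  obtain ⟨v, hv⟩ := exists_hasVal_qPoch_div φ hz k
  have hX := HasVal.var φ z
  have hA := HasVal.const φ z a
  have hB := HasVal.const φ z b
  have n1 : qPoch (z ^ 4 / φ a) (z ^ 4) k ≠ 0 := prod_ne_zero_iff.2 fun i _ h => by
    refine hg.a_sub (4 + 4 * i) ?_
    have ha := hg.a_ne_zero
    rw [pow_add, pow_mul]
    calc _ = φ a * (1 - z ^ 4 / φ a * (z ^ 4) ^ i) := by field_simp
      _ = 0 := by rw [h, mul_zero]
  have n2 : qPoch (φ a * z ^ 4) (z ^ 4) k ≠ 0 := prod_ne_zero_iff.2 fun i _ => by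
    rw [mul_assoc, ← pow_mul, ← pow_add]; exact hg.one_sub_a _
  have n3 : qPoch (φ b * z ^ 2) (z ^ 2) k ≠ 0 := prod_ne_zero_iff.2 fun i _ => by
    rw [mul_assoc, ← pow_mul, ← pow_add]; exact hg.one_sub_b _
  have hnum := (((hA.mul hX).qPoch (hX.pow 2) k).mul
    ((hX.div hA hg.a_ne_zero).qPoch (hX.pow 2) k)).mul
    ((hX.div hB hg.b_ne_zero).qPoch (hX.pow 4) k)
  have hden := ((((hX.pow 4).div hA hg.a_ne_zero).qPoch (hX.pow 4) k).mul
    ((hA.mul (hX.pow 4)).qPoch (hX.pow 4) k)).mul ((hB.mul (hX.pow 2)).qPoch (hX.pow 2) k)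
  refine ⟨_, (((hv.mul (hnum.div hden (mul_ne_zero (mul_ne_zero n1 n2) n3))).mul
    (hX.pow (k ^ 2 + k))).mul (hB.pow k)).congr ?_⟩
  simp only [qTerm, div_eq_mul_inv, mul_inv]
  ring

lemma Generic.exists_hasVal_block {a b : K} (hg : Generic z (φ a) (φ b)) {m : ℕ}
    (hq : IsPrimitiveRoot z m) (hm : Odd m) (hz : ∀ j : ℕ, 1 + z ^ j ≠ 0) (l : ℕ) :
    ∃ w, ∀ k < m, HasVal φ z (qTerm RatFunc.X (RatFunc.C a) (RatFunc.C b) (l * m + k))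
      (w * qTerm z (φ a) (φ b) k) := by
  obtain ⟨w, hw⟩ := hg.exists_hasVal hz (l * m)
  refine ⟨w, fun k => ?_⟩
  induction k with
  | zero => simpa using fun _ => hw
  | succ k ih =>
    intro hk
    have hd : ¬ m ∣ k + 1 := Nat.not_dvd_of_pos_of_lt (by omega) hk
    have per : ∀ r : ℕ, (z ^ r) ^ (l * m + k) = (z ^ r) ^ k := fun r => by
      rw [pow_add, ← pow_mul, mul_comm l, mul_left_comm, pow_mul, hq.pow_eq_one, one_pow, one_mul]
    have hX := HasVal.var φ z
    have hA := HasVal.const φ z a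
    have hB := HasVal.const φ z b
    have h1 := HasVal.one φ z
    have x2 := (hX.pow 2).pow (l * m + k)
    have x4 := (hX.pow 4).pow (l * m + k)
    rw [per] at x2 x4
    have n1 : 1 - z ^ 4 * (z ^ 4) ^ k ≠ 0 := by
      rw [← pow_succ', ← pow_mul]; exact hq.one_sub_pow_ne_zero (not_dvd_four_mul hm hd)
    have n2 : 1 - z ^ 4 / φ a * (z ^ 4) ^ k ≠ 0 := fun h => by
      refine hg.a_sub (4 + 4 * k) ?_
      have ha := hg.a_ne_zero
      rw [pow_add, pow_mul]
      calc _ = φ a * (1 - z ^ 4 / φ a * (z ^ 4) ^ k) := by field_simp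
        _ = 0 := by rw [h, mul_zero]
    have n3 : 1 - φ a * z ^ 4 * (z ^ 4) ^ k ≠ 0 := by
      rw [mul_assoc, ← pow_mul, ← pow_add]; exact hg.one_sub_a _
    have n4 : 1 - φ b * z ^ 2 * (z ^ 2) ^ k ≠ 0 := by
      rw [mul_assoc, ← pow_mul, ← pow_add]; exact hg.one_sub_b _
    rw [← add_assoc, qTerm_succ, qTerm_succ, ← mul_assoc w]
    exact (ih (by omega)).mul ((HasVal.div
      ((((h1.sub (hX.mul x2)).mul (h1.sub ((hA.mul hX).mul x2))).mul
        (h1.sub ((hX.div hA hg.a_ne_zero).mul x2))).mul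
        (h1.sub ((hX.div hB hg.b_ne_zero).mul x4)))
      ((((h1.sub ((hX.pow 4).mul x4)).mul
        (h1.sub (((hX.pow 4).div hA hg.a_ne_zero).mul x4))).mul
        (h1.sub ((hA.mul (hX.pow 4)).mul x4))).mul (h1.sub ((hB.mul (hX.pow 2)).mul x2)))
      (mul_ne_zero (mul_ne_zero (mul_ne_zero n1 n2) n3) n4)).mul (((hX.pow 2).mul x2).mul hB))

/-- Sums over a block of residues, full or cut after the middle, vanish at `z`. -/
lemma Generic.hasVal_sum_block {a b : K} (hg : Generic z (φ a) (φ b)) {N : ℕ}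
    (hq : IsPrimitiveRoot z (2 * N + 1)) (hN : 0 < N) (ha : φ a ^ (2 * N + 1) ≠ 1)
    (hz : ∀ j : ℕ, 1 + z ^ j ≠ 0) (l : ℕ) {M : ℕ} (hM : N < M) (hM' : M ≤ 2 * N + 1) :
    HasVal φ z (∑ k ∈ range M, _root_.qint RatFunc.X (6 * (l * (2 * N + 1) + k) + 1) *
      qTerm RatFunc.X (RatFunc.C a) (RatFunc.C b) (l * (2 * N + 1) + k)) 0 := by
  obtain ⟨w, hw⟩ := hg.exists_hasVal_block hq ⟨N, rfl⟩ hz l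
  have h1 : 1 - z ≠ 0 := sub_ne_zero.2 (hq.ne_one (by omega)).symm
  have key : ∀ j ≤ M, HasVal φ z
      (∑ k ∈ range j, _root_.qint RatFunc.X (6 * (l * (2 * N + 1) + k) + 1) *
        qTerm RatFunc.X (RatFunc.C a) (RatFunc.C b) (l * (2 * N + 1) + k))
      (w * ∑ k ∈ range j, _root_.qint z (6 * k + 1) * qTerm z (φ a) (φ b) k) := by
    intro j
    induction j with
    | zero => simpa using HasVal.zero φ z
    | succ j ih =>
      intro hj
      have e : _root_.qint z (6 * (l * (2 * N + 1) + j) + 1) = _root_.qint z (6 * j + 1) := by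
        refine mul_right_cancel₀ h1 ?_
        rw [qint_mul, qint_mul, show 6 * (l * (2 * N + 1) + j) + 1 =
          (2 * N + 1) * (6 * l) + (6 * j + 1) by ring, pow_add, pow_mul, hq.pow_eq_one, one_pow,
          one_mul]
      have h := (HasVal.var φ z).qint (6 * (l * (2 * N + 1) + j) + 1)
      rw [e] at h
      rw [sum_range_succ, sum_range_succ, mul_add w, mul_left_comm w]
      exact (ih (by omega)).add (h.mul (hw j (by omega)))
  simpa [hg.sum_qint_eq_zero hq hN ha hM] using key M le_rfl

lemma Generic.hasVal_sum {a b : K} (hg : Generic z (φ a) (φ b)) {N : ℕ}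
    (hq : IsPrimitiveRoot z (2 * N + 1)) (hN : 0 < N) (ha : φ a ^ (2 * N + 1) ≠ 1)
    (hz : ∀ j : ℕ, 1 + z ^ j ≠ 0) (l : ℕ) :
    HasVal φ z (∑ k ∈ range (l * (2 * N + 1)), _root_.qint RatFunc.X (6 * k + 1) *
      qTerm RatFunc.X (RatFunc.C a) (RatFunc.C b) k) 0 ∧
    HasVal φ z (∑ k ∈ range (l * (2 * N + 1) + (N + 1)), _root_.qint RatFunc.X (6 * k + 1) *
      qTerm RatFunc.X (RatFunc.C a) (RatFunc.C b) k) 0 := by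
  have full : HasVal φ z (∑ k ∈ range (l * (2 * N + 1)), _root_.qint RatFunc.X (6 * k + 1) *
      qTerm RatFunc.X (RatFunc.C a) (RatFunc.C b) k) 0 := by
    induction l with
    | zero => simpa using HasVal.zero φ z
    | succ l ih =>
      rw [add_mul, one_mul, sum_range_add]
      simpa using ih.add (hg.hasVal_sum_block hq hN ha hz l (by omega) le_rfl)
  refine ⟨full, ?_⟩
  rw [sum_range_add]
  simpa using full.add (hg.hasVal_sum_block hq hN ha hz l N.lt_succ_self (by omega))

end HasVal

lemma Generic.of_pow_ne_one {K : Type*} [Field K] {z a b : K} {n : ℕ}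
    (hz : z ^ n = 1) (ha : a ≠ 0) (hb : b ≠ 0) (han : a ^ n ≠ 1) (hbn : b ^ n ≠ 1) :
    Generic z a b := by
  have hj : ∀ j : ℕ, (z ^ j) ^ n = 1 := fun j => by rw [pow_right_comm, hz, one_pow]
  have h1 : ∀ (x : K) (j : ℕ), x ^ n ≠ 1 → x - z ^ j ≠ 0 := fun x j hx h =>
    hx (by rw [sub_eq_zero.1 h, hj])
  have h2 : ∀ (x : K) (j : ℕ), x ^ n ≠ 1 → 1 - x * z ^ j ≠ 0 := fun x j hx h =>
    hx (calc x ^ n = x ^ n * (z ^ j) ^ n := by rw [hj, mul_one]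
      _ = 1 := by rw [← mul_pow, ← sub_eq_zero.1 h, one_pow])
  exact ⟨ha, hb, fun j => h1 a j han, fun j => h2 a j han, fun j => h1 b j hbn,
    fun j => h2 b j hbn⟩

/-- Roots of unity test for divisibility by `1 + X + ⋯ + X ^ (n - 1)`. -/
lemma geom_sum_dvd_of_eval₂_eq_zero {K L : Type*} [Field K] [Field L] (φ : K →+* L) {n : ℕ}
    {w : L} (hn : 0 < n) (hw : IsPrimitiveRoot w n) {P : Polynomial K}
    (h : ∀ z : L, z ^ n = 1 → z ≠ 1 → P.eval₂ φ z = 0) :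
    (∑ i ∈ range n, (Polynomial.X : Polynomial K) ^ i) ∣ P := by
  rw [← Polynomial.map_dvd_map' φ, Polynomial.map_sum]
  simp only [Polynomial.map_pow, Polynomial.map_X]
  have hX : (Polynomial.X - 1 : Polynomial L) ≠ 0 := Polynomial.X_sub_C_ne_zero 1
  refine (mul_dvd_mul_iff_right hX).1 ?_
  rw [geom_sum_mul, Polynomial.X_pow_sub_one_eq_prod hn hw]
  refine prod_dvd_of_coprime (fun x _ y _ hxy =>
    Polynomial.pairwise_coprime_X_sub_C Function.injective_id hxy) fun z hz => ?_
  rw [Polynomial.dvd_iff_isRoot, Polynomial.IsRoot, Polynomial.eval_mul, Polynomial.eval_map]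
  by_cases h1 : z = 1
  · simp [h1]
  · rw [h z ((Polynomial.mem_nthRootsFinset hn _).1 hz) h1, zero_mul]

lemma algebraMap_X_pow_ne_one (i : Fin 2) {n : ℕ} (hn : n ≠ 0) :
    (algebraMap (MvPolynomial (Fin 2) ℚ) Qab (MvPolynomial.X i)) ^ n ≠ 1 := by
  rw [← map_pow, ← map_one (algebraMap (MvPolynomial (Fin 2) ℚ) Qab)]
  intro h
  have h' := congrArg (MvPolynomial.eval 0) (IsFractionRing.injective _ Qab h)
  simp [hn] at h'

lemma algebraMap_X_ne_zero (i : Fin 2) :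
    algebraMap (MvPolynomial (Fin 2) ℚ) Qab (MvPolynomial.X i) ≠ 0 := by
  rw [Ne, map_eq_zero_iff _ (IsFractionRing.injective _ Qab)]
  exact MvPolynomial.X_ne_zero i

lemma one_add_pow_ne_zero {L : Type*} [Field L] [CharZero L] {z : L} {n : ℕ} (hn : Odd n)
    (hz : z ^ n = 1) (j : ℕ) : 1 + z ^ j ≠ 0 := fun h => by
  have e : z ^ j = -1 := by linear_combination h
  have h' : (z ^ j) ^ n = 1 := by rw [pow_right_comm, hz, one_pow]
  rw [e, hn.neg_one_pow] at h'
  norm_num at h'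

theorem stmt_10 (n : ℕ) (hn : 1 < n) (hodd : Odd n) (M : ℕ)
    (hM : M = (n - 1) / 2 ∨ M = n - 1) :
    (∑ i ∈ Finset.range n, (Polynomial.X : Polynomial Qab) ^ i) ∣
      (∑ k ∈ Finset.range (M + 1),
          qint (RatFunc.X : RatFunc Qab) (6 * k + 1) *
            (qPoch RatFunc.X (RatFunc.X ^ 2) k *
              qPoch (aa * RatFunc.X) (RatFunc.X ^ 2) k *
              qPoch (RatFunc.X / aa) (RatFunc.X ^ 2) k) *
            qPoch (RatFunc.X / bb) (RatFunc.X ^ 4) k /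
            ((qPoch ((RatFunc.X : RatFunc Qab) ^ 4) (RatFunc.X ^ 4) k *
                qPoch ((RatFunc.X : RatFunc Qab) ^ 4 / aa) (RatFunc.X ^ 4) k *
                qPoch (aa * RatFunc.X ^ 4) (RatFunc.X ^ 4) k) *
              qPoch (bb * RatFunc.X ^ 2) (RatFunc.X ^ 2) k) *
            RatFunc.X ^ (k ^ 2 + k) * bb ^ k).num := by
  have hn0 : n ≠ 0 := by omega
  have : NeZero (n : AlgebraicClosure Qab) := ⟨Nat.cast_ne_zero.2 hn0⟩
  obtain ⟨w, hw⟩ := HasEnoughRootsOfUnity.exists_primitiveRoot (AlgebraicClosure Qab) n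
  refine geom_sum_dvd_of_eval₂_eq_zero (algebraMap Qab (AlgebraicClosure Qab)) (by omega) hw
    fun z hz hz1 => HasVal.eval₂_num_eq_zero ?_
  set φ := algebraMap Qab (AlgebraicClosure Qab)
  set α := algebraMap (MvPolynomial (Fin 2) ℚ) Qab (MvPolynomial.X 0)
  set β := algebraMap (MvPolynomial (Fin 2) ℚ) Qab (MvPolynomial.X 1)
  have hα : ∀ r ≠ 0, φ α ^ r ≠ 1 := fun r hr h =>
    algebraMap_X_pow_ne_one 0 hr (φ.injective (by rw [map_pow, map_one]; exact h))
  have hβ : ∀ r ≠ 0, φ β ^ r ≠ 1 := fun r hr h =>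
    algebraMap_X_pow_ne_one 1 hr (φ.injective (by rw [map_pow, map_one]; exact h))
  have hg : Generic z (φ α) (φ β) := Generic.of_pow_ne_one hz
    ((map_ne_zero φ).2 (algebraMap_X_ne_zero 0)) ((map_ne_zero φ).2 (algebraMap_X_ne_zero 1))
    (hα n hn0) (hβ n hn0)
  obtain ⟨r, hr⟩ := orderOf_dvd_of_pow_eq_one hz
  have hrm : Odd (orderOf z * r) := hr ▸ hodd
  obtain ⟨⟨N, hN⟩, ⟨s, hs⟩⟩ := Nat.odd_mul.1 hrm
  have hq : IsPrimitiveRoot z (2 * N + 1) := hN ▸ IsPrimitiveRoot.orderOf z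
  have hN0 : 0 < N := by
    rcases Nat.eq_zero_or_pos N with h | h
    · subst h
      exact absurd (by simpa using hq.pow_eq_one) hz1
    · exact h
  have hnr : n = r * (2 * N + 1) := by rw [hr, hN, mul_comm]
  have key : HasVal φ z (∑ k ∈ Finset.range (M + 1), qint RatFunc.X (6 * k + 1) *
      qTerm RatFunc.X (RatFunc.C α) (RatFunc.C β) k) 0 := by
    rcases hM with h | h
    · have e : M + 1 = s * (2 * N + 1) + (N + 1) := by
        have : n = 2 * (s * (2 * N + 1) + N) + 1 := by rw [hnr, hs]; ring
        omega
      rw [e]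
      exact (hg.hasVal_sum hq hN0 (hα _ (by omega)) (one_add_pow_ne_zero hodd hz) s).2
    · rw [h, Nat.sub_add_cancel hn.le, hnr]
      exact (hg.hasVal_sum hq hN0 (hα _ (by omega)) (one_add_pow_ne_zero hodd hz) r).1
  refine key.congr (Finset.sum_congr rfl fun k _ => ?_)
  rw [qTerm, aa, bb]
  simp only [mul_div_assoc, mul_assoc, α, β]
end
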